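/- arXiv:2304.04954 — 2 statements merged into one kernel-verified Lean document; each statement's English description precedes it below -/
import Mathlib

section
/- Let U be a finite universe and let A be a conservative paging algorithm over U. Let k, α be positive integers with α dividing k, let δ be a real with 0 < δ < 1 such that δ·k is a natural number, (1−δ)⁻¹ ≤ k/(2α), and let k' := (1−δ)·k. Let c be a positive integer, let s := ⌈16·exp(8·δ²·α/(1−δ))⌉ and t := c·α·s². Suppose |U| ≥ s·k'. Then there exists a request sequence σ over U of length at most c·α·k·s³ such that, with probability at least 1 − exp(−k/(2α)) ≥ 1 − e⁻¹ over the uniformly random hash function h : U → Fin(k/α), C(localA_k, σ) ≥ c·C(A_{k'}, σ) + c·s·k. -/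
open scoped Classical

namespace SetAssoc

variable {U : Type*} [DecidableEq U]

/-- The paging cost of a cache-state function `X` on request sequence `σ`:
the number of indices `i` with `σ_i ∉ X (σ_1 … σ_{i-1})`. -/
def cost (X : List U → Finset U) (σ : List U) : ℕ :=
  ∑ i : Fin σ.length, if σ.get i ∈ X (σ.take i.1) then 0 else 1

/-- `A` is a paging algorithm: empty cache initially, items are fetched only when
requested, and the cache of size `k` holds at most `k` items. -/
def IsPagingAlg (A : ℕ → List U → Finset U) : Prop :=
  (∀ k, A k [] = ∅) ∧
  (∀ k σ x, A k (σ ++ [x]) ⊆ insert x (A k σ)) ∧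
  (∀ k σ, (A k σ).card ≤ k)

/-- The set of items evicted by `A_k` in response to a request `z` after serving `τ`. -/
def Out (A : ℕ → List U → Finset U) (k : ℕ) (τ : List U) (z : U) : Finset U :=
  A k τ \ A k (τ ++ [z])

/-- `A` is lazy: a hit changes nothing, a miss with a non-full cache just inserts the item,
and a miss with a full cache inserts the item and evicts exactly one cached item. -/
def IsLazy (A : ℕ → List U → Finset U) : Prop :=
  ∀ (k : ℕ) (σ : List U) (x : U),
    (x ∈ A k σ → A k (σ ++ [x]) = A k σ) ∧
    (x ∉ A k σ → (A k σ).card < k → A k (σ ++ [x]) = insert x (A k σ)) ∧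
    (x ∉ A k σ → (A k σ).card = k →
      ∃ y ∈ A k σ, A k (σ ++ [x]) = insert x (A k σ) \ {y})

/-- `τ[X]`: the subsequence of `τ` consisting of the requests to items of `X`. -/
noncomputable def restrict (τ : List U) (X : Set U) : List U :=
  τ.filter (fun a => decide (a ∈ X))

/-- `A` is stable. -/
def IsStable (A : ℕ → List U → Finset U) : Prop :=
  ∀ (τ : List U) (X : Set U) (z : U), z ∈ X →
    ∀ a b : ℕ, b < a →
      (Out A b (restrict τ X) z ∩ A a (τ ++ [z])).Nonempty →
      A b (restrict τ X ++ [z]) ⊆ A a (τ ++ [z])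

/-- `A` is a stack algorithm. -/
def IsStack (A : ℕ → List U → Finset U) : Prop :=
  ∀ (k : ℕ) (σ : List U), A k σ ⊆ A (k + 1) σ

/-- `A` conforms to the family of orders `r` (where `r σ x y` means `x ⪯_σ y`). -/
def Conforms (A : ℕ → List U → Finset U) (r : List U → U → U → Prop) : Prop :=
  ∀ (τ : List U) (z : U) (k : ℕ) (x y : U),
    x ∈ A k τ → x ∉ Out A k τ z → y ∈ Out A k τ z → r (τ ++ [z]) x y

/-- The family of orders `r` is monotone. -/
def MonotoneFam (r : List U → U → U → Prop) : Prop :=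
  ∀ (σ : List U) (x y z : U), x ∈ σ → y ∈ σ → z ∈ σ → y ≠ z →
    r σ x y → r (σ ++ [z]) x y

/-- The family of orders `r` is self-similar. -/
def SelfSimilarFam (r : List U → U → U → Prop) : Prop :=
  ∀ (σ : List U) (X : Set U) (x y : U),
    x ∈ restrict σ X → y ∈ restrict σ X → r (restrict σ X) x y → r σ x y


/-- The subsequence of `σ` consisting of the requests mapped to bucket `b` by `h`. -/
def bucketSeq {n : ℕ} (h : U → Fin n) (b : Fin n) (σ : List U) : List U :=
  σ.filter (fun u => decide (h u = b))

/-- The cost of the `α`-way set-associative version of `A` (with `n = k/α` buckets)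
under the hash function `h`: the sum over buckets of the cost of `A_α` on the
subsequence of requests mapped to that bucket. -/
def localCost (A : ℕ → List U → Finset U) (α : ℕ) {n : ℕ} (h : U → Fin n)
    (σ : List U) : ℕ :=
  ∑ b : Fin n, cost (A α) (bucketSeq h b σ)

/-- The items evicted by the set-associative version of `A` on a request `z` after
serving `τ`: the eviction happens in the bucket `h z` of the requested item. -/
def localOut (A : ℕ → List U → Finset U) (α : ℕ) {n : ℕ} (h : U → Fin n)
    (τ : List U) (z : U) : Finset U :=
  A α (bucketSeq h (h z) τ) \ A α (bucketSeq h (h z) (τ ++ [z]))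
/-- `A` is conservative: on any consecutive subsequence of the input containing at most
`k` distinct items, `A_k` incurs at most `k` cache misses. -/
def IsConservative (A : ℕ → List U → Finset U) : Prop :=
  ∀ (k : ℕ) (pre mid : List U), mid.toFinset.card ≤ k →
    cost (A k) (pre ++ mid) - cost (A k) pre ≤ k


theorem cost_concat (X : List U → Finset U) (σ : List U) (x : U) :
    cost X (σ ++ [x]) = cost X σ + if x ∈ X σ then 0 else 1 := by
  have cost_eq_sum_range (τ : List U) : cost X τ =
      ∑ i ∈ Finset.range τ.length,
        if ∃ y ∈ X (τ.take i), τ[i]? = some y then 0 else 1 := by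
    rw [Finset.sum_range]
    exact Finset.sum_congr rfl fun i _ => by simp
  rw [cost_eq_sum_range, cost_eq_sum_range, List.length_append, List.length_singleton,
    Finset.sum_range_succ]
  congr 1
  · refine Finset.sum_congr rfl fun i hi => ?_
    have hi' : i < σ.length := Finset.mem_range.1 hi
    rw [List.take_append_of_le_length hi'.le, List.getElem?_append_left hi']
  · simp

theorem cost_le_cost_append (X : List U → Finset U) (σ τ : List U) :
    cost X σ ≤ cost X (σ ++ τ) := by
  induction τ using List.reverseRecOn with
  | nil => simp
  | append_singleton τ x ih =>
    rw [← List.append_assoc, cost_concat]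
    omega

theorem subset_of_cost_append_eq {X : List U → Finset U}
    (hX : ∀ σ x, X (σ ++ [x]) ⊆ insert x (X σ)) (σ τ : List U)
    (h : cost X (σ ++ τ) = cost X σ) : τ.toFinset ⊆ X σ ∧ X (σ ++ τ) ⊆ X σ := by
  induction τ using List.reverseRecOn with
  | nil => simp
  | append_singleton τ x ih =>
    have h1 := cost_le_cost_append X σ τ
    rw [← List.append_assoc, cost_concat] at h
    obtain ⟨h2, h3⟩ := ih (by omega)
    have hx : x ∈ X (σ ++ τ) := by
      by_contra hx
      rw [if_neg hx] at h
      omega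
    refine ⟨?_, ?_⟩
    · intro y hy
      simp only [List.toFinset_append, Finset.mem_union, List.mem_toFinset,
        List.mem_singleton] at hy
      rcases hy with hy | rfl
      · exact h2 (List.mem_toFinset.2 hy)
      · exact h3 hx
    · rw [← List.append_assoc]
      refine (hX _ _).trans ?_
      rw [Finset.insert_eq_of_mem hx]
      exact h3

theorem cost_add_le_cost_append_replicate {X : List U → Finset U} {α : ℕ}
    (hX : ∀ σ x, X (σ ++ [x]) ⊆ insert x (X σ)) (hcard : ∀ σ, (X σ).card ≤ α)
    {l : List U} (hl : α < l.toFinset.card) (σ : List U) (t : ℕ) :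
    cost X σ + t ≤ cost X (σ ++ (List.replicate t l).flatten) := by
  induction t generalizing σ with
  | zero => simp
  | succ t ih =>
    have h1 := ih (σ ++ l)
    have h2 := cost_le_cost_append X σ l
    have h3 : cost X (σ ++ l) ≠ cost X σ := fun h =>
      absurd (Finset.card_le_card (subset_of_cost_append_eq hX σ l h).1)
        (by have := hcard σ; omega)
    rw [List.replicate_succ, List.flatten_cons, ← List.append_assoc]
    omega

/-- The request sequence that serves each list in `L` repeatedly, `t` times in a row. -/
def repeatBlocks (t : ℕ) (L : List (List U)) : List U :=
  (L.map fun l => (List.replicate t l).flatten).flatten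

theorem le_cost_repeatBlocks {X : List U → Finset U} {α : ℕ}
    (hX : ∀ σ x, X (σ ++ [x]) ⊆ insert x (X σ)) (hcard : ∀ σ, (X σ).card ≤ α)
    {l : List U} (hl : α < l.toFinset.card) {L : List (List U)} (hL : l ∈ L) (t : ℕ) :
    t ≤ cost X (repeatBlocks t L) := by
  obtain ⟨L₁, L₂, rfl⟩ := List.append_of_mem hL
  have h1 := cost_add_le_cost_append_replicate hX hcard hl (repeatBlocks t L₁) t
  have h2 := cost_le_cost_append X (repeatBlocks t L₁ ++ (List.replicate t l).flatten)
    (repeatBlocks t L₂)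
  have h3 : repeatBlocks t (L₁ ++ l :: L₂) =
      repeatBlocks t L₁ ++ (List.replicate t l).flatten ++ repeatBlocks t L₂ := by
    simp [repeatBlocks]
  rw [h3]
  omega

theorem cost_repeatBlocks_le {A : ℕ → List U → Finset U} (hcons : IsConservative A)
    (k t : ℕ) (L : List (List U)) (hL : ∀ l ∈ L, l.toFinset.card ≤ k) :
    cost (A k) (repeatBlocks t L) ≤ L.length * k := by
  induction L using List.reverseRecOn with
  | nil =>
    refine (Finset.sum_eq_zero fun i _ => i.elim0).trans_le (Nat.zero_le _)
  | append_singleton L l ih =>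
    have h1 := ih fun l' hl' => hL l' (by simp [hl'])
    have h2 : repeatBlocks t (L ++ [l]) =
        repeatBlocks t L ++ (List.replicate t l).flatten := by
      simp [repeatBlocks]
    have h3 : (List.replicate t l).flatten.toFinset ⊆ l.toFinset := by
      intro x hx
      simp only [List.mem_toFinset, List.mem_flatten, List.mem_replicate] at hx ⊢
      obtain ⟨_, ⟨-, rfl⟩, hx⟩ := hx
      exact hx
    have h4 := hcons k (repeatBlocks t L) (List.replicate t l).flatten
      ((Finset.card_le_card h3).trans (hL l (by simp)))
    rw [h2, List.length_append, List.length_singleton, Nat.add_mul, one_mul]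
    omega

omit [DecidableEq U] in
theorem bucketSeq_repeatBlocks {n : ℕ} (h : U → Fin n) (b : Fin n) (t : ℕ)
    (L : List (List U)) :
    bucketSeq h b (repeatBlocks t L) = repeatBlocks t (L.map (bucketSeq h b)) := by
  simp [bucketSeq, repeatBlocks, List.filter_flatten, Function.comp_def]

omit [DecidableEq U] in
theorem length_repeatBlocks (t m : ℕ) (L : List (List U)) (hL : ∀ l ∈ L, l.length = m) :
    (repeatBlocks t L).length = L.length * (t * m) := by
  induction L with
  | nil => simp [repeatBlocks]
  | cons l L ih =>
    have h1 := ih fun l' hl' => hL l' (by simp [hl'])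
    have h2 := hL l (by simp)
    have h3 : repeatBlocks t (l :: L) =
        (List.replicate t l).flatten ++ repeatBlocks t L := by
      simp [repeatBlocks]
    rw [h3, List.length_append, h1]
    simp [h2]
    ring

/-- The number of elements of a finite type that satisfy `P`. -/
noncomputable def count {Ω : Type*} [Fintype Ω] (P : Ω → Prop) : ℕ :=
  (Finset.univ.filter P).card

theorem count_eq_sum_count {Ω γ : Type*} [Fintype Ω] [Fintype γ] (P : Ω → Prop) (f : Ω → γ) :
    count P = ∑ c, count fun ω => P ω ∧ f ω = c := by
  unfold count
  rw [Finset.card_eq_sum_card_fiberwise (f := f) (t := Finset.univ) (fun _ _ => by simp)]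
  refine Finset.sum_congr rfl fun c _ => ?_
  rw [Finset.filter_filter]
  congr!

theorem count_mul_count_le_of_injOn {Ω : Type*} [Fintype Ω] {P Q P' Q' : Ω → Prop}
    (f : Ω × Ω → Ω × Ω) (hf : ∀ p, P p.1 → Q p.2 → P' (f p).1 ∧ Q' (f p).2)
    (hinj : Function.Injective f) : count P * count Q ≤ count P' * count Q' := by
  unfold count
  rw [← Finset.card_product, ← Finset.card_product]
  refine Finset.card_le_card_of_injOn f (fun p hp => ?_) hinj.injOn
  simp only [Finset.coe_product, Finset.coe_filter, Finset.mem_univ, true_and,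
    Set.mem_prod, Set.mem_ofPred_eq] at hp ⊢
  exact hf p hp.1 hp.2

theorem injective_piecewise_swap {β : Type*} (X : Finset U) :
    Function.Injective fun p : (U → β) × (U → β) =>
      (X.piecewise p.1 p.2, X.piecewise p.2 p.1) := by
  rintro ⟨h, g⟩ ⟨h', g'⟩ heq
  simp only [Prod.mk.injEq] at heq
  refine Prod.ext (funext fun x => ?_) (funext fun x => ?_) <;>
    by_cases hx : x ∈ X
  · simpa [hx] using congrFun heq.1 x
  · simpa [hx] using congrFun heq.2 x
  · simpa [hx] using congrFun heq.2 x
  · simpa [hx] using congrFun heq.1 x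

theorem count_true {Ω : Type*} [Fintype Ω] : count (fun _ : Ω => True) = Fintype.card Ω := by
  simp [count]

theorem count_eq_card_filter {Ω : Type*} [Fintype Ω] (P : Ω → Prop) [DecidablePred P] :
    count P = (Finset.univ.filter P).card := by
  unfold count
  congr!

theorem count_eq_zero {Ω : Type*} [Fintype Ω] {P : Ω → Prop} (h : ∀ ω, ¬ P ω) : count P = 0 := by
  simp [count, h]

theorem count_and_mul_card_le_of_disjoint_support {β : Type*} [Fintype U] [Fintype β]
    (X : Finset U) (P R : (U → β) → Prop)
    (hP : ∀ g g' : U → β, (∀ x ∈ X, g x = g' x) → P g → P g')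
    (hR : ∀ g g' : U → β, (∀ x ∉ X, g x = g' x) → R g → R g') :
    count (fun h : U → β => P h ∧ R h) * Fintype.card (U → β) ≤
      count P * count R := by
  rw [← count_true]
  refine count_mul_count_le_of_injOn _ (fun p hp _ => ?_) (injective_piecewise_swap X)
  exact ⟨hP p.1 _ (fun x hx => by simp [hx]) hp.1, hR p.1 _ (fun x hx => by simp [hx]) hp.2⟩

theorem count_forall_le_pow_of_disjoint_support {ι β : Type*} [Fintype U] [Fintype β]
    [Nonempty β] (X : ι → Finset U) (hX : Pairwise fun i j => Disjoint (X i) (X j))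
    (P : ι → (U → β) → Prop)
    (hP : ∀ i, ∀ g g' : U → β, (∀ x ∈ X i, g x = g' x) → P i g → P i g')
    (r : ℝ) (hr : ∀ i, (count (P i) : ℝ) ≤ r * Fintype.card (U → β))
    (J : Finset ι) :
    (count (fun h : U → β => ∀ i ∈ J, P i h) : ℝ) ≤
      r ^ J.card * Fintype.card (U → β) := by
  induction J using Finset.induction_on with
  | empty => simp [count_true]
  | insert j J hj ih =>
    have hN : (0 : ℝ) < Fintype.card (U → β) := by exact_mod_cast Fintype.card_pos
    have h1 := count_and_mul_card_le_of_disjoint_support (X j) (P j)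
      (fun h => ∀ i ∈ J, P i h) (hP j) fun g g' hg h i hi =>
        hP i g g' (fun x hx => hg x fun hx' =>
          Finset.disjoint_left.1 (hX (fun hij => hj (hij ▸ hi) : i ≠ j)) hx hx') (h i hi)
    have h1' : (count (fun h : U → β => P j h ∧ ∀ i ∈ J, P i h) : ℝ) *
        Fintype.card (U → β) ≤ count (P j) *
          count (fun h : U → β => ∀ i ∈ J, P i h) := by
      exact_mod_cast h1
    simp only [Finset.forall_mem_insert]
    rw [Finset.card_insert_of_notMem hj, pow_succ']
    refine le_of_mul_le_mul_right (h1'.trans ?_) hN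
    calc _ ≤ (r * Fintype.card (U → β)) * (r ^ J.card * Fintype.card (U → β)) := by
          have := (Nat.cast_nonneg _).trans (hr j)
          gcongr
          exact hr j
      _ = _ := by ring

/-- The set of items that `h` maps to `b`. -/
noncomputable def fiber {β : Type*} [Fintype U] (h : U → β) (b : β) : Finset U :=
  Finset.univ.filter fun u => h u = b

theorem count_fiber_and_mul_card_le {β : Type*} [Fintype U] [Fintype β]
    (D : Finset U → Prop) (hD : ∀ T T', T ⊆ T' → D T' → D T) (b : β) (S : Finset β)
    (hb : b ∉ S) :
    count (fun h : U → β => D (fiber h b) ∧ ∀ b' ∈ S, D (fiber h b')) *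
        Fintype.card (U → β) ≤
      count (fun h : U → β => D (fiber h b)) *
        count (fun h : U → β => ∀ b' ∈ S, D (fiber h b')) := by
  rw [← count_true, count_eq_sum_count (fun h : U → β => D (fiber h b) ∧ _) (fiber · b),
    count_eq_sum_count (fun _ : U → β => True) (fiber · b),
    count_eq_sum_count (fun h : U → β => D (fiber h b)) (fiber · b),
    count_eq_sum_count (fun h : U → β => ∀ b' ∈ S, D (fiber h b')) (fiber · b)]
  refine four_functions_theorem_univ _ _ _ _ (fun _ => Nat.zero_le _) (fun _ => Nat.zero_le _)
    (fun _ => Nat.zero_le _) (fun _ => Nat.zero_le _) fun a c => ?_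
  refine count_mul_count_le_of_injOn _ ?_ (injective_piecewise_swap c)
  · rintro ⟨h, g⟩ ⟨⟨hDb, hDS⟩, ha⟩ ⟨-, hc⟩
    have hmem_a (x : U) : x ∈ a ↔ h x = b := by simp [← ha, fiber]
    have hmem_c (x : U) : x ∈ c ↔ g x = b := by simp [← hc, fiber]
    have h1 : fiber (c.piecewise h g) b = a ⊓ c := by
      ext x
      by_cases hx : x ∈ c
      · simp [fiber, hx, hmem_a]
      · simp [fiber, hx, ← hmem_c]
    have h2 : fiber (c.piecewise g h) b = a ⊔ c := by
      ext x
      by_cases hx : x ∈ c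
      · simp [fiber, hx, ← hmem_c]
      · simp [fiber, hx, hmem_a]
    refine ⟨⟨?_, h1⟩, ?_, h2⟩
    · rw [h1]
      exact hD _ _ Finset.inter_subset_left (ha ▸ hDb)
    · intro b' hb'
      refine hD _ _ (fun x hx => ?_) (hDS b' hb')
      simp only [fiber, Finset.mem_filter, Finset.mem_univ, true_and] at hx ⊢
      by_cases hxc : x ∈ c
      · rw [Finset.piecewise_eq_of_mem _ _ _ hxc, (hmem_c x).1 hxc] at hx
        exact absurd (hx ▸ hb') hb
      · rwa [Finset.piecewise_eq_of_notMem _ _ _ hxc] at hx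

theorem count_forall_fiber_le_pow {β : Type*} [Fintype U] [Fintype β] [Nonempty β]
    (D : Finset U → Prop) (hD : ∀ T T', T ⊆ T' → D T' → D T) (r : ℝ)
    (hr : ∀ b : β, (count (fun h : U → β => D (fiber h b)) : ℝ) ≤
      r * Fintype.card (U → β)) (S : Finset β) :
    (count (fun h : U → β => ∀ b ∈ S, D (fiber h b)) : ℝ) ≤
      r ^ S.card * Fintype.card (U → β) := by
  induction S using Finset.induction_on with
  | empty => simp [count_true]
  | insert b S hb ih =>
    have hN : (0 : ℝ) < Fintype.card (U → β) := by exact_mod_cast Fintype.card_pos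
    have h1 : (count (fun h : U → β =>
          D (fiber h b) ∧ ∀ b' ∈ S, D (fiber h b')) : ℝ) * Fintype.card (U → β) ≤
        count (fun h : U → β => D (fiber h b)) *
          count (fun h : U → β => ∀ b' ∈ S, D (fiber h b')) := by
      exact_mod_cast count_fiber_and_mul_card_le D hD b S hb
    simp only [Finset.forall_mem_insert]
    rw [Finset.card_insert_of_notMem hb, pow_succ']
    refine le_of_mul_le_mul_right (h1.trans ?_) hN
    calc _ ≤ (r * Fintype.card (U → β)) * (r ^ S.card * Fintype.card (U → β)) := by
          have := (Nat.cast_nonneg _).trans (hr b)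
          gcongr
          exact hr b
      _ = _ := by ring

theorem choose_succ_mul_pow (m j : ℕ) (hj : j ≤ m) (θ : ℝ) :
    (m.choose (j + 1) : ℝ) * θ ^ (j + 1) * (j + 1) = m.choose j * θ ^ j * (θ * (m - j)) := by
  have h : (m.choose (j + 1) : ℝ) * (j + 1) = m.choose j * (m - j) := by
    have := Nat.choose_succ_right_eq m j
    rw [← Nat.cast_sub hj]
    exact_mod_cast this
  linear_combination θ ^ (j + 1) * h

theorem choose_mul_pow_le_choose_mul_pow_reflect {a b : ℕ} (hab : a ≤ b) (j i : ℕ)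
    (ha : a = j + 1 + i) :
    ((a + b).choose i : ℝ) * (a / b) ^ i ≤ (a + b).choose (a + j) * (a / b) ^ (a + j) := by
  induction j generalizing i with
  | zero =>
    have hb : (0 : ℝ) < b := by exact_mod_cast (by omega : 0 < b)
    have h := choose_succ_mul_pow (a + b) i (by omega) (a / b)
    have ha' : (a : ℝ) = i + 1 := by rw [ha]; push_cast; ring
    have e : a + 0 = i + 1 := by omega
    rw [e]
    have hw : (0 : ℝ) ≤ (a + b).choose i * (a / b) ^ i := by positivity
    refine le_of_mul_le_mul_right ?_ (by positivity : (0 : ℝ) < i + 1)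
    rw [h]
    refine mul_le_mul_of_nonneg_left ?_ hw
    push_cast
    rw [div_mul_eq_mul_div, le_div_iff₀ hb, ← ha']
    have : (0 : ℝ) ≤ a := by positivity
    nlinarith
  | succ j ih =>
    have hb : (0 : ℝ) < b := by exact_mod_cast (by omega : 0 < b)
    have ih := ih (i + 1) (by omega)
    have h1 := choose_succ_mul_pow (a + b) i (by omega) (a / b)
    have h2 := choose_succ_mul_pow (a + b) (a + j) (by omega) (a / b)
    have e : a + (j + 1) = a + j + 1 := by omega
    rw [e]
    set w0 := ((a + b).choose i : ℝ) * (a / b) ^ i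
    set w1 := ((a + b).choose (i + 1) : ℝ) * (a / b) ^ (i + 1)
    set w2 := ((a + b).choose (a + j) : ℝ) * (a / b) ^ (a + j)
    set w3 := ((a + b).choose (a + j + 1) : ℝ) * (a / b) ^ (a + j + 1)
    have hw0 : 0 ≤ w0 := by positivity
    have ha' : (a : ℝ) = j + 2 + i := by rw [ha]; push_cast; ring
    have hab' : (a : ℝ) ≤ b := by exact_mod_cast hab
    push_cast at h1 h2
    have hjb : (0 : ℝ) ≤ b - j := by
      have : (0 : ℝ) ≤ i := by positivity
      linarith
    have hpos : (0 : ℝ) < (i + 1) * (a + j + 1) := by positivity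
    refine le_of_mul_le_mul_right ?_ hpos
    have h3 : w3 * ((i + 1) * (a + j + 1)) = w2 * ((a / b) * (b - j)) * (i + 1) := by
      linear_combination (i + 1) * h2
    have h4 : w1 * ((a / b) * (b - j)) * (i + 1) ≤ w2 * ((a / b) * (b - j)) * (i + 1) := by
      gcongr
    have h5 : w1 * ((a / b) * (b - j)) * (i + 1)
        = w0 * ((a / b) * (a + b - i) * ((a / b) * (b - j))) := by
      linear_combination ((a / b) * (b - j)) * h1
    rw [h3]
    refine le_trans ?_ h4
    rw [h5]
    refine mul_le_mul_of_nonneg_left ?_ hw0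
    have h6 : (a : ℝ) / b * (a + b - i) * (a / b * (b - j)) =
      a ^ 2 * ((a + b - i) * (b - j)) / b ^ 2 := by field_simp
    rw [h6, le_div_iff₀ (by positivity)]
    have hi : (i : ℝ) = a - (j + 2) := by linarith
    rw [hi]
    have h7 : (a : ℝ) ^ 2 * ((a + b - (a - (j + 2))) * (b - j)) -
        (a - (j + 2) + 1) * (a + j + 1) * b ^ 2 =
        a ^ 2 * (2 * b + 1) + (j + 1) ^ 2 * ((b - a) * (b + a)) := by ring
    have h8 : 0 ≤ (a : ℝ) ^ 2 * (2 * b + 1) + (j + 1) ^ 2 * ((b - a) * (b + a)) := by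
      have : (0 : ℝ) ≤ b - a := by linarith
      positivity
    linarith

open Finset in
theorem sum_choose_mul_pow_le_three_mul_sum {a b : ℕ} (ha : 0 < a) (hab : a ≤ b) :
    ∑ j ∈ range (a + 1), ((a + b).choose j : ℝ) * (a / b) ^ j ≤
      3 * ∑ j ∈ Ico (a + 1) (a + b + 1), ((a + b).choose j : ℝ) * (a / b) ^ j := by
  set w : ℕ → ℝ := fun j => ((a + b).choose j : ℝ) * (a / b) ^ j with hw
  change ∑ j ∈ range (a + 1), w j ≤ 3 * ∑ j ∈ Ico (a + 1) (a + b + 1), w j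
  have hw0 (j : ℕ) : 0 ≤ w j := by positivity
  have hb : (0 : ℝ) < b := by exact_mod_cast (by omega : 0 < b)
  have hb1 : (1 : ℝ) ≤ b := by exact_mod_cast (by omega : 1 ≤ b)
  have hsucc (j : ℕ) (hj : j ≤ a + b) : w (j + 1) = w j * (a * (a + b - j)) / ((j + 1) * b) := by
    have := choose_succ_mul_pow (a + b) j hj (a / b)
    push_cast at this
    rw [eq_div_iff (by positivity)]
    simp only [hw]
    field_simp at this ⊢
    linear_combination this
  have hhigh : w (a + 1) + w (a + 2) ≤ ∑ j ∈ Ico (a + 1) (a + b + 1), w j := by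
    by_cases h : a + 2 < a + b + 1
    · have : ({a + 1, a + 2} : Finset ℕ) ⊆ Ico (a + 1) (a + b + 1) := by
        intro x; simp; omega
      rw [← sum_pair (by omega : a + 1 ≠ a + 2)]
      exact sum_le_sum_of_subset_of_nonneg this fun j _ _ => hw0 j
    · have h2 : w (a + 2) = 0 := by
        simp only [hw]
        rw [Nat.choose_eq_zero_of_lt (by omega)]
        simp
      rw [h2, add_zero]
      exact single_le_sum (fun j _ => hw0 j) (by simp; omega)
  rcases Nat.lt_or_ge a 3 with h3 | h3
  · refine le_trans ?_ (mul_le_mul_of_nonneg_left hhigh (by norm_num))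
    obtain rfl | rfl : a = 1 ∨ a = 2 := by omega
    · have e0 : w 0 = 1 := by simp [hw]
      have e1 := hsucc 0 (by omega)
      have e2 := hsucc 1 (by omega)
      have e3 := hsucc 2 (by omega)
      norm_num at e1 e2 e3
      simp only [sum_range_succ, sum_range_zero]
      norm_num
      rw [e3, e2, e1, e0]
      field_simp
      nlinarith
    · have e0 : w 0 = 1 := by simp [hw]
      have e1 := hsucc 0 (by omega)
      have e2 := hsucc 1 (by omega)
      have e3 := hsucc 2 (by omega)
      have e4 := hsucc 3 (by omega)
      norm_num at e1 e2 e3 e4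
      simp only [sum_range_succ, sum_range_zero]
      norm_num
      rw [e4, e3, e2, e1, e0]
      field_simp
      have : (2 : ℝ) ≤ b := by exact_mod_cast hab
      nlinarith [mul_nonneg (sub_nonneg.2 this) (sub_nonneg.2 this), pow_pos hb 3]
  · have hlow : ∑ j ∈ range a, w j ≤ ∑ j ∈ Ico a (a + a), w j := by
      rw [← sum_range_reflect, sum_Ico_eq_sum_range, Nat.add_sub_cancel]
      refine sum_le_sum fun j hj => ?_
      have hj := mem_range.1 hj
      exact choose_mul_pow_le_choose_mul_pow_reflect hab j (a - 1 - j) (by omega)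
    have hle : ∑ j ∈ Ico a (a + a), w j ≤ ∑ j ∈ Ico a (a + b + 1), w j :=
      sum_le_sum_of_subset_of_nonneg (Ico_subset_Ico le_rfl (by omega)) fun j _ _ => hw0 j
    rw [sum_eq_sum_Ico_succ_bot (by omega : a < a + b + 1)] at hle
    have hmid : w a ≤ w (a + 1) + w (a + 2) := by
      have e1 := hsucc a (by omega)
      have e2 := hsucc (a + 1) (by omega)
      push_cast at e1 e2
      have ha3 : (3 : ℝ) ≤ a := by exact_mod_cast h3
      have hab' : (a : ℝ) ≤ b := by exact_mod_cast hab
      have e : w (a + 1) + w (a + 2) =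
          w a * (a / (a + 1) * (1 + a * (b - 1) / ((a + 2) * b))) := by
        rw [e2, e1]
        field_simp
        ring
      rw [e]
      refine le_mul_of_one_le_right (hw0 a) ?_
      rw [div_mul_eq_mul_div, le_div_iff₀ (by positivity), one_mul, mul_add, mul_one]
      gcongr
      rw [mul_div_assoc', le_div_iff₀ (by positivity)]
      nlinarith [mul_nonneg (sub_nonneg.2 ha3) (sub_nonneg.2 hab'),
        mul_nonneg (mul_nonneg (sub_nonneg.2 ha3) (sub_nonneg.2 ha3)) (sub_nonneg.2 hab')]
    rw [sum_range_succ]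
    linarith

open Finset in
/-- Change of measure between two binomial laws, by the Cauchy–Schwarz inequality. -/
theorem sq_sum_binomial_le {m : ℕ} {p q : ℝ} (hp0 : 0 < p) (hp1 : p < 1)
    (s : Finset ℕ) (hs : s ⊆ range (m + 1)) :
    (∑ j ∈ s, (m.choose j : ℝ) * q ^ j * (1 - q) ^ (m - j)) ^ 2 ≤
      (∑ j ∈ s, (m.choose j : ℝ) * p ^ j * (1 - p) ^ (m - j)) *
        Real.exp (m * ((q - p) ^ 2 / (p * (1 - p)))) := by
  have hp1' : 0 < 1 - p := by linarith
  have hcs := sum_sq_le_sum_mul_sum_of_sq_le_mul s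
    (r := fun j => (m.choose j : ℝ) * q ^ j * (1 - q) ^ (m - j))
    (f := fun j => (m.choose j : ℝ) * p ^ j * (1 - p) ^ (m - j))
    (g := fun j => (q ^ 2 / p) ^ j * ((1 - q) ^ 2 / (1 - p)) ^ (m - j) * (m.choose j : ℝ))
    (fun j _ => by positivity) (fun j _ => by positivity) (fun j _ => by
      refine le_of_eq ?_
      simp only [div_pow]
      generalize 1 - p = v at hp1' ⊢
      generalize 1 - q = u
      field_simp
      ring)
  refine hcs.trans (mul_le_mul_of_nonneg_left ?_ (sum_nonneg fun j _ => by positivity))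
  calc _ ≤ ∑ j ∈ range (m + 1),
        (q ^ 2 / p) ^ j * ((1 - q) ^ 2 / (1 - p)) ^ (m - j) * (m.choose j : ℝ) :=
        sum_le_sum_of_subset_of_nonneg hs fun j _ _ => by positivity
    _ = ((q - p) ^ 2 / (p * (1 - p)) + 1) ^ m := by
        rw [← add_pow]
        congr 1
        field_simp
        ring
    _ ≤ Real.exp ((q - p) ^ 2 / (p * (1 - p))) ^ m := by
        gcongr
        exact Real.add_one_le_exp _
    _ = _ := by rw [← Real.exp_nat_mul]

open Finset in
theorem exp_le_sum_binomial_tail {m a : ℕ} (ha : 0 < a) (ham : 2 * a ≤ m) {δ p : ℝ}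
    (hδ0 : 0 < δ) (hδ1 : δ < 1) (hp : p * m = (1 - δ) * a) :
    1 / 16 * Real.exp (-(8 * δ ^ 2 * a / (1 - δ))) ≤
      ∑ j ∈ Ico (a + 1) (m + 1), (m.choose j : ℝ) * p ^ j * (1 - p) ^ (m - j) := by
  obtain ⟨b, rfl⟩ : ∃ b, m = a + b := ⟨m - a, by omega⟩
  have hab : a ≤ b := by omega
  have ha' : (0 : ℝ) < a := by exact_mod_cast ha
  have hab' : (a : ℝ) ≤ b := by exact_mod_cast hab
  have hb' : (0 : ℝ) < b := by linarith
  have hδ' : 0 < 1 - δ := by linarith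
  push_cast at hp
  set q : ℝ := a / (a + b) with hq
  have hpq : p = (1 - δ) * q := by
    rw [hq, ← mul_div_assoc, eq_div_iff (by positivity), hp]
  have hq0 : 0 < q := by positivity
  have hq2 : q ≤ 1 / 2 := by
    rw [hq, div_le_div_iff₀ (by positivity) (by norm_num)]
    linarith
  have hp0 : 0 < p := by rw [hpq]; positivity
  have hp2 : p ≤ 1 / 2 := by rw [hpq]; nlinarith
  have h1 := sq_sum_binomial_le (m := a + b) (q := q) hp0 (by linarith)
    (Ico (a + 1) (a + b + 1)) (fun x => by simp)
  have h2 : 1 / 4 ≤ ∑ j ∈ Ico (a + 1) (a + b + 1),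
      ((a + b).choose j : ℝ) * q ^ j * (1 - q) ^ (a + b - j) := by
    have hterm (j : ℕ) (hj : j ≤ a + b) :
        ((a + b).choose j : ℝ) * q ^ j * (1 - q) ^ (a + b - j) =
          (1 - q) ^ (a + b) * ((a + b).choose j * (a / b) ^ j) := by
      have hq' : q = (1 - q) * (a / b) := by
        rw [hq]
        field_simp
        ring
      obtain ⟨i, hi⟩ := Nat.exists_eq_add_of_le hj
      rw [hi, Nat.add_sub_cancel_left, pow_add]
      nth_rw 1 [hq']
      rw [mul_pow]
      ring
    have htot : ∑ j ∈ range (a + b + 1),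
        ((a + b).choose j : ℝ) * q ^ j * (1 - q) ^ (a + b - j) = 1 := by
      have := add_pow q (1 - q) (a + b)
      rw [add_sub_cancel, one_pow] at this
      refine Eq.trans (sum_congr rfl fun j _ => ?_) this.symm
      ring
    have h3 := sum_choose_mul_pow_le_three_mul_sum ha hab
    rw [range_eq_Ico, ← sum_Ico_consecutive _ (Nat.zero_le (a + 1))
      (by omega : a + 1 ≤ a + b + 1)] at htot
    have hlow : ∑ j ∈ Ico 0 (a + 1),
        ((a + b).choose j : ℝ) * q ^ j * (1 - q) ^ (a + b - j) ≤
        3 * ∑ j ∈ Ico (a + 1) (a + b + 1),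
          ((a + b).choose j : ℝ) * q ^ j * (1 - q) ^ (a + b - j) := by
      rw [sum_congr rfl fun j hj => hterm j (by have := mem_Ico.1 hj; omega),
        sum_congr rfl fun j hj => hterm j (by have := mem_Ico.1 hj; omega),
        ← mul_sum, ← mul_sum, mul_left_comm, ← range_eq_Ico]
      exact mul_le_mul_of_nonneg_left h3 (pow_nonneg (by linarith) _)
    linarith
  have h4 : ((a + b : ℕ) : ℝ) * ((q - p) ^ 2 / (p * (1 - p))) ≤ 8 * δ ^ 2 * a / (1 - δ) := by
    have e : ((a + b : ℕ) : ℝ) * ((q - p) ^ 2 / (p * (1 - p))) =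
        δ ^ 2 * a / (1 - δ) * (1 - p)⁻¹ := by
      have hm : ((a + b : ℕ) : ℝ) = a / q := by
        rw [hq]
        push_cast
        field_simp
      have hp1 : 1 - p ≠ 0 := by linarith
      have hqp : q - p = δ * q := by rw [hpq]; ring
      rw [hm, hqp]
      nth_rw 1 [hpq]
      field_simp
    have h5 : (1 - p)⁻¹ ≤ 8 := by
      rw [inv_le_comm₀ (by linarith) (by norm_num)]
      linarith
    calc _ = δ ^ 2 * a / (1 - δ) * (1 - p)⁻¹ := e
      _ ≤ δ ^ 2 * a / (1 - δ) * 8 := by gcongr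
      _ = _ := by ring
  rw [Real.exp_neg, ← div_eq_mul_inv, div_le_iff₀ (Real.exp_pos _)]
  have hp1' : 0 ≤ 1 - p := by linarith
  calc (1 : ℝ) / 16 = (1 / 4) ^ 2 := by norm_num
    _ ≤ _ := pow_le_pow_left₀ (by norm_num) h2 2
    _ ≤ _ := h1
    _ ≤ _ := by gcongr

theorem count_inter_fiber_eq {n : ℕ} [Fintype U] (hn : 0 < n) (X T : Finset U) (hT : T ⊆ X)
    (b : Fin n) :
    (count (fun h : U → Fin n => X ∩ fiber h b = T) : ℝ) =
      (1 / n : ℝ) ^ T.card * (1 - 1 / n) ^ (X.card - T.card) *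
        Fintype.card (U → Fin n) := by
  have hn' : (n : ℝ) ≠ 0 := by positivity
  have h1 : count (fun h : U → Fin n => X ∩ fiber h b = T) =
      (Fintype.piFinset fun x : U =>
        if x ∈ T then {b} else if x ∈ X then Finset.univ.erase b else Finset.univ).card := by
    unfold count
    congr 1
    ext h
    simp only [Finset.mem_filter, Finset.mem_univ, true_and, Fintype.mem_piFinset,
      Finset.ext_iff, Finset.mem_inter, fiber]
    refine forall_congr' fun x => ?_
    by_cases hxT : x ∈ T
    · simp [hxT, hT hxT]
    · by_cases hxX : x ∈ X <;> simp [hxT, hxX]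
  have h2 (x : U) : (((if x ∈ T then {b} else if x ∈ X then Finset.univ.erase b
      else Finset.univ : Finset (Fin n)).card : ℕ) : ℝ) =
      n * if x ∈ X then (if x ∈ T then (1 / n : ℝ) else 1 - 1 / n) else 1 := by
    by_cases hxT : x ∈ T
    · simp [hxT, hT hxT, hn']
    · by_cases hxX : x ∈ X
      · simp only [hxT, hxX, if_true, if_false, Finset.card_erase_of_mem (Finset.mem_univ b),
          Finset.card_univ, Fintype.card_fin]
        rw [Nat.cast_pred hn]
        field_simp
      · simp [hxT, hxX]
  rw [h1, Fintype.card_piFinset, Nat.cast_prod, Finset.prod_congr rfl fun x _ => h2 x,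
    Finset.prod_mul_distrib, Finset.prod_ite_mem, Finset.univ_inter,
    Finset.prod_ite, Finset.prod_const, Finset.prod_const, Finset.prod_const,
    Finset.filter_mem_eq_inter, Finset.inter_eq_right.2 hT, ← Finset.sdiff_eq_filter,
    Finset.card_sdiff_of_subset hT, Finset.card_univ, Fintype.card_fun, Fintype.card_fin,
    Nat.cast_pow]
  ring

theorem count_card_inter_fiber_le {n : ℕ} [Fintype U] (hn : 0 < n) (X : Finset U) (b : Fin n)
    (a : ℕ) :
    (count (fun h : U → Fin n => (X ∩ fiber h b).card ≤ a) : ℝ) ≤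
      (1 - ∑ j ∈ Finset.Ico (a + 1) (X.card + 1),
        (X.card.choose j : ℝ) * (1 / n) ^ j * (1 - 1 / n) ^ (X.card - j)) *
        Fintype.card (U → Fin n) := by
  set N : ℝ := ((Fintype.card (U → Fin n) : ℕ) : ℝ) with hN
  have h1 : (count (fun h : U → Fin n => (X ∩ fiber h b).card ≤ a) : ℝ) =
      ∑ T ∈ X.powerset, if T.card ≤ a then
        (1 / n : ℝ) ^ T.card * (1 - 1 / n) ^ (X.card - T.card) * N else 0 := by
    rw [count_eq_sum_count _ fun h : U → Fin n => X ∩ fiber h b, Nat.cast_sum,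
      ← Finset.sum_subset (Finset.subset_univ X.powerset)]
    · refine Finset.sum_congr rfl fun T hT => ?_
      split_ifs with hTa
      · rw [← count_inter_fiber_eq hn X T (Finset.mem_powerset.1 hT) b]
        congr 2
        ext h
        exact ⟨fun h => h.2, fun h => ⟨h ▸ hTa, h⟩⟩
      · refine Nat.cast_eq_zero.2 (count_eq_zero ?_)
        rintro h ⟨h2, rfl⟩
        exact hTa h2
    · intro T _ hT
      refine Nat.cast_eq_zero.2 (count_eq_zero ?_)
      rintro h ⟨-, rfl⟩
      exact hT (Finset.mem_powerset.2 Finset.inter_subset_left)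
  have h2 := Finset.sum_powerset_apply_card (fun j => if j ≤ a then
    (1 / n : ℝ) ^ j * (1 - 1 / n) ^ (X.card - j) * N else 0) (x := X)
  have h3 : ∑ j ∈ Finset.range (X.card + 1),
      (X.card.choose j : ℝ) * (1 / n) ^ j * (1 - 1 / n) ^ (X.card - j) = 1 := by
    have := add_pow (1 / n : ℝ) (1 - 1 / n) X.card
    rw [add_sub_cancel, one_pow] at this
    refine Eq.trans (Finset.sum_congr rfl fun j _ => ?_) this.symm
    ring
  have h4 : Finset.Ico (a + 1) (X.card + 1) =
      (Finset.range (X.card + 1)).filter fun j => ¬ j ≤ a := by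
    ext j
    simp
    omega
  have h5 := Finset.sum_filter_add_sum_filter_not (Finset.range (X.card + 1)) (· ≤ a)
    fun j => (X.card.choose j : ℝ) * (1 / n) ^ j * (1 - 1 / n) ^ (X.card - j)
  rw [h3] at h5
  rw [h1, h2, h4, ← eq_sub_of_add_eq h5, Finset.sum_mul, Finset.sum_filter]
  refine le_of_eq (Finset.sum_congr rfl fun j _ => ?_)
  split_ifs
  · rw [nsmul_eq_mul]
    ring
  · simp

theorem count_many_fibers_le {n : ℕ} [Fintype U] (hn : 0 < n)
    (D : Finset U → Prop) (hD : ∀ T T', T ⊆ T' → D T' → D T)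
    (hr : ∀ b : Fin n, (count (fun h : U → Fin n => D (fiber h b)) : ℝ) ≤
      Real.exp (-1) * Fintype.card (U → Fin n)) :
    (count (fun h : U → Fin n => 7 * n < 8 * count fun b => D (fiber h b)) : ℝ) ≤
      Real.exp (-n / 2) * Fintype.card (U → Fin n) := by
  have : Nonempty (Fin n) := ⟨⟨0, hn⟩⟩
  set N : ℝ := ((Fintype.card (U → Fin n) : ℕ) : ℝ)
  set y : ℝ := Real.exp (5 / 2) - 1 with hy
  have hy0 : 0 ≤ y := by
    have := Real.add_one_le_exp (5 / 2 : ℝ)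
    linarith
  have hpow (h : U → Fin n) : Real.exp (5 / 2) ^ (count fun b => D (fiber h b)) =
      ∑ S : Finset (Fin n), if ∀ b ∈ S, D (fiber h b) then y ^ S.card else 0 := by
    have h1 := Finset.sum_pow_mul_eq_add_pow y 1 (Finset.univ.filter fun b => D (fiber h b))
    simp only [one_pow, mul_one] at h1
    rw [← Finset.sum_filter, count, show Real.exp (5 / 2) = y + 1 by rw [hy]; ring, ← h1]
    refine Finset.sum_congr ?_ fun _ _ => rfl
    ext S
    simp [Finset.subset_iff]
  have hmoment : ∑ h : U → Fin n, Real.exp (5 / 2) ^ (count fun b => D (fiber h b)) ≤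
      (y * Real.exp (-1) + 1) ^ n * N := by
    simp_rw [hpow]
    rw [Finset.sum_comm]
    calc _ = ∑ S : Finset (Fin n), y ^ S.card *
          (count (fun h : U → Fin n => ∀ b ∈ S, D (fiber h b)) : ℝ) := by
          refine Finset.sum_congr rfl fun S _ => ?_
          rw [← Finset.sum_filter, Finset.sum_const, nsmul_eq_mul, mul_comm,
            count_eq_card_filter]
      _ ≤ ∑ S : Finset (Fin n), y ^ S.card * (Real.exp (-1) ^ S.card * N) := by
          gcongr with S
          exact count_forall_fiber_le_pow D hD _ hr S
      _ = _ := by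
          have h1 := Finset.sum_pow_mul_eq_add_pow (y * Real.exp (-1)) 1
            (Finset.univ : Finset (Fin n))
          simp only [one_pow, mul_one, Finset.powerset_univ, Finset.card_univ,
            Fintype.card_fin] at h1
          rw [← h1, Finset.sum_mul]
          exact Finset.sum_congr rfl fun S _ => by rw [mul_pow]; ring
  have hmarkov : (count (fun h : U → Fin n => 7 * n < 8 * count fun b => D (fiber h b)) : ℝ) *
      Real.exp (35 / 16 * n) ≤
      ∑ h : U → Fin n, Real.exp (5 / 2) ^ (count fun b => D (fiber h b)) := by
    rw [count_eq_card_filter, ← nsmul_eq_mul, ← Finset.sum_const]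
    refine (Finset.sum_le_sum fun h hh => ?_).trans
      (Finset.sum_le_sum_of_subset_of_nonneg (Finset.subset_univ _) fun _ _ _ => by positivity)
    rw [← Real.exp_nat_mul, Real.exp_le_exp]
    have : (7 * n : ℝ) < 8 * (count fun b => D (fiber h b) : ℕ) := by
      exact_mod_cast (Finset.mem_filter.1 hh).2
    linarith
  have hnum : y * Real.exp (-1) + 1 ≤ Real.exp (27 / 16) := by
    have e1 : Real.exp (5 / 2) * Real.exp (-1) = Real.exp (3 / 2) := by
      rw [← Real.exp_add]; norm_num
    have e2 : Real.exp (27 / 16) = Real.exp (3 / 2) * Real.exp (3 / 16) := by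
      rw [← Real.exp_add]; norm_num
    have h1 := Real.add_one_le_exp (3 / 16 : ℝ)
    have h2 := Real.quadratic_le_exp_of_nonneg (by norm_num : (0 : ℝ) ≤ 3 / 2)
    have h3 : (9 / 25 : ℝ) ≤ Real.exp (-1) := by
      rw [Real.exp_neg, le_inv_comm₀ (by norm_num) (Real.exp_pos _)]
      linarith [Real.exp_one_lt_d9]
    rw [e2, hy, sub_mul, e1]
    nlinarith [Real.exp_pos (3 / 2)]
  have hN0 : 0 ≤ N := by positivity
  have hfin := hmarkov.trans (hmoment.trans (mul_le_mul_of_nonneg_right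
    (pow_le_pow_left₀ (by positivity) hnum n) hN0))
  rw [← Real.exp_nat_mul, ← le_div_iff₀ (Real.exp_pos _)] at hfin
  refine hfin.trans_eq ?_
  rw [mul_div_right_comm, ← Real.exp_sub]
  congr 2
  ring

theorem mul_card_le_localCost_repeatBlocks {A : ℕ → List U → Finset U}
    (hpaging : IsPagingAlg A) [Fintype U] {n : ℕ} (α t : ℕ) (h : U → Fin n)
    (L : List (List U)) :
    t * (count fun b => ∃ l ∈ L, α < (l.toFinset ∩ fiber h b).card) ≤
      localCost A α h (repeatBlocks t L) := by
  rw [localCost, count_eq_card_filter, mul_comm, ← smul_eq_mul, ← Finset.sum_const]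
  refine (Finset.sum_le_sum fun b hb => ?_).trans
    (Finset.sum_le_sum_of_subset (Finset.subset_univ _))
  obtain ⟨l, hl, hlα⟩ := (Finset.mem_filter.1 hb).2
  rw [bucketSeq_repeatBlocks]
  refine le_cost_repeatBlocks (hpaging.2.1 α) (hpaging.2.2 α) (l := bucketSeq h b l) ?_
    (List.mem_map_of_mem hl) t
  convert hlα using 2
  ext x
  simp [bucketSeq, fiber]

theorem count_add_count_not {Ω : Type*} [Fintype Ω] (P : Ω → Prop) :
    count P + (count fun ω => ¬ P ω) = Fintype.card Ω := by
  unfold count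
  rw [← Finset.card_univ, ← Finset.card_filter_add_card_filter_not (s := Finset.univ) P]
  congr!

theorem count_forall_blocks_le {ι : Type*} [Fintype ι] [Nonempty ι] {n : ℕ} [Fintype U]
    (hn : 0 < n) (X : ι → Finset U) (hX : Pairwise fun i j => Disjoint (X i) (X j)) {m : ℕ}
    (hm : ∀ i, (X i).card = m) (a : ℕ)
    (hp : 1 ≤ (Fintype.card ι : ℝ) * ∑ j ∈ Finset.Ico (a + 1) (m + 1),
        (m.choose j : ℝ) * (1 / n) ^ j * (1 - 1 / n) ^ (m - j)) (b : Fin n) :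
    (count (fun h : U → Fin n => ∀ i, (X i ∩ fiber h b).card ≤ a) : ℝ) ≤
      Real.exp (-1) * Fintype.card (U → Fin n) := by
  have : Nonempty (Fin n) := ⟨b⟩
  set P := ∑ j ∈ Finset.Ico (a + 1) (m + 1),
    (m.choose j : ℝ) * (1 / n) ^ j * (1 - 1 / n) ^ (m - j)
  have hN : (0 : ℝ) < Fintype.card (U → Fin n) := by exact_mod_cast Fintype.card_pos
  have hr (i : ι) := count_card_inter_fiber_le hn (X i) b a
  simp only [hm] at hr
  have h1 := count_forall_le_pow_of_disjoint_support X hX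
    (fun i (h : U → Fin n) => (X i ∩ fiber h b).card ≤ a) (fun i g g' hg h => by
      convert h using 2
      ext x
      simp only [fiber, Finset.mem_inter, Finset.mem_filter, Finset.mem_univ, true_and]
      exact and_congr_right fun hx => by rw [hg x hx]) (1 - P) hr Finset.univ
  simp only [Finset.mem_univ, true_imp_iff] at h1
  have hP : 0 ≤ 1 - P :=
    nonneg_of_mul_nonneg_left ((Nat.cast_nonneg _).trans (hr (Classical.arbitrary ι))) hN
  refine h1.trans (mul_le_mul_of_nonneg_right ?_ hN.le)
  rw [Finset.card_univ]
  calc (1 - P) ^ Fintype.card ι ≤ Real.exp (-P) ^ Fintype.card ι := by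
        gcongr
        exact Real.one_sub_le_exp_neg P
    _ = Real.exp (Fintype.card ι * -P) := by rw [← Real.exp_nat_mul]
    _ ≤ Real.exp (-1) := by
        rw [Real.exp_le_exp]
        linarith

/-- **Lower bound (Theorem 5.1).** For a conservative paging algorithm `A`, with
`α ∣ k`, `0 < δ < 1`, `k' = (1-δ)k ∈ ℕ`, `(1-δ)⁻¹ ≤ k/(2α)`, `c ≥ 1`,
`s = ⌈16·exp(8δ²α/(1-δ))⌉` and `|U| ≥ s·k'`, there is a request sequence `σ` of length
at most `c·α·k·s³` on which, with probability at least `1 - exp(-k/(2α)) ≥ 1 - e⁻¹`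
over the uniformly random hash function, `C(localA_k, σ) ≥ c·C(A_{k'}, σ) + c·s·k`. -/
theorem setAssociative_lower_bound
    [Fintype U] (A : ℕ → List U → Finset U)
    (hpaging : IsPagingAlg A) (hcons : IsConservative A)
    (k α : ℕ) (hk : 0 < k) (hα : 0 < α) (hdvd : α ∣ k)
    (δ : ℝ) (hδ0 : 0 < δ) (hδ1 : δ < 1)
    (k' : ℕ) (hk' : (k' : ℝ) = (1 - δ) * k)
    (hra : (1 - δ)⁻¹ ≤ (k : ℝ) / (2 * α))
    (c : ℕ) (hc : 0 < c)
    (s : ℕ) (hs : s = ⌈(16 : ℝ) * Real.exp (8 * δ ^ 2 * α / (1 - δ))⌉₊)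
    (hU : s * k' ≤ Fintype.card U) :
    (1 : ℝ) - Real.exp (-(k : ℝ) / (2 * α)) ≥ 1 - Real.exp (-1) ∧
    ∃ σ : List U, σ.length ≤ c * α * k * s ^ 3 ∧
      (1 : ℝ) - Real.exp (-(k : ℝ) / (2 * α)) ≤
        ((Finset.univ.filter (fun h : U → Fin (k / α) =>
            c * cost (A k') σ + c * s * k ≤ localCost A α h σ)).card : ℝ) /
          (Fintype.card (U → Fin (k / α)) : ℝ) := by
  have hα' : (0 : ℝ) < α := by exact_mod_cast hα
  have hδ' : 0 < 1 - δ := by linarith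
  obtain ⟨n, rfl⟩ := hdvd
  have hn : 0 < n := Nat.pos_of_ne_zero (by rintro rfl; simp at hk)
  have hn' : (0 : ℝ) < n := by exact_mod_cast hn
  rw [Nat.mul_div_cancel_left n hα]
  push_cast at hk' hra ⊢
  have hnα : (α * n : ℝ) / (2 * α) = n / 2 := by field_simp
  have hnα' : -(α * n : ℝ) / (2 * α) = -n / 2 := by field_simp
  rw [hnα] at hra
  rw [hnα']
  refine ⟨?_, ?_⟩
  · have h1 : 1 ≤ (1 - δ)⁻¹ := (one_le_inv₀ hδ').2 (by linarith)
    have h2 : Real.exp (-n / 2) ≤ Real.exp (-1) := Real.exp_le_exp.2 (by linarith)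
    linarith
  have hs_le : 16 * Real.exp (8 * δ ^ 2 * α / (1 - δ)) ≤ s := by
    rw [hs]
    exact Nat.le_ceil _
  have hs16 : 16 ≤ s := by
    have h1 : (16 : ℝ) ≤ s := by
      have := Real.one_le_exp (x := 8 * δ ^ 2 * α / (1 - δ)) (by positivity)
      linarith
    exact_mod_cast h1
  have : Nonempty (Fin s) := ⟨⟨0, by omega⟩⟩
  have hk'k : k' ≤ α * n := by
    have : (k' : ℝ) ≤ (α * n : ℕ) := by
      rw [hk']
      push_cast
      nlinarith [mul_pos hα' hn']
    exact_mod_cast this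
  have hαk' : 2 * α ≤ k' := by
    have : (2 * α : ℝ) ≤ k' := by
      rw [inv_le_iff_one_le_mul₀ hδ'] at hra
      rw [hk']
      nlinarith
    exact_mod_cast this
  obtain ⟨e⟩ : Nonempty (Fin s × Fin k' ↪ U) :=
    Function.Embedding.nonempty_of_card_le (by simpa using hU)
  let block (i : Fin s) : List U := List.ofFn fun j => e (i, j)
  let L : List (List U) := List.ofFn block
  let t : ℕ := c * α * s ^ 2
  have hblock (i : Fin s) : (block i).toFinset.card = k' := by
    rw [List.toFinset_card_of_nodup]
    · simp [block]
    · exact List.nodup_ofFn.2 fun j j' hj => by simpa using hj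
  have hdisj : Pairwise fun i j => Disjoint (block i).toFinset (block j).toFinset := by
    intro i i' hi
    rw [Finset.disjoint_left]
    intro x hx hx'
    simp only [block, List.mem_toFinset, List.mem_ofFn] at hx hx'
    obtain ⟨j, rfl⟩ := hx
    obtain ⟨j', hj'⟩ := hx'
    exact hi (congrArg Prod.fst (e.injective hj')).symm
  have hL {p : List U → Prop} : (∃ l ∈ L, p l) ↔ ∃ i, p (block i) := by
    simp [L, List.mem_ofFn]
  refine ⟨repeatBlocks t L, ?_, ?_⟩
  · rw [length_repeatBlocks t k' L (by simp [L, block, List.mem_ofFn])]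
    calc L.length * (t * k') = c * α * k' * s ^ 3 := by
          simp only [L, t, List.length_ofFn]
          ring
      _ ≤ c * α * (α * n) * s ^ 3 := by gcongr
  have htail := exp_le_sum_binomial_tail (p := 1 / n) hα hαk' hδ0 hδ1 (by
    rw [hk']
    field_simp)
  have hbucket := count_forall_blocks_le hn (fun i => (block i).toFinset) hdisj hblock α (by
    rw [Fintype.card_fin]
    calc (1 : ℝ) = 16 * Real.exp (8 * δ ^ 2 * α / (1 - δ)) *
          (1 / 16 * Real.exp (-(8 * δ ^ 2 * α / (1 - δ)))) := by
          rw [Real.exp_neg]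
          field_simp
      _ ≤ _ := by gcongr)
  have hmany := count_many_fibers_le hn
    (fun T => ∀ i, ((block i).toFinset ∩ T).card ≤ α)
    (fun T T' hT h i =>
      (Finset.card_le_card (Finset.inter_subset_inter_left hT)).trans (h i)) hbucket
  have hcost : cost (A k') (repeatBlocks t L) ≤ s * k' := by
    refine (cost_repeatBlocks_le hcons k' t L ?_).trans_eq (by simp [L])
    intro l hl
    obtain ⟨i, rfl⟩ := List.mem_ofFn.1 hl
    exact (hblock i).le
  have hgood (h : U → Fin n) (hh : ¬ 7 * n < 8 * count fun b =>
      ∀ i, ((block i).toFinset ∩ fiber h b).card ≤ α) :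
      c * cost (A k') (repeatBlocks t L) + c * s * (α * n) ≤
        localCost A α h (repeatBlocks t L) := by
    have h1 := mul_card_le_localCost_repeatBlocks hpaging α t h L
    have h2 := count_add_count_not fun b : Fin n =>
      ∀ i, ((block i).toFinset ∩ fiber h b).card ≤ α
    simp only [hL] at h1
    simp only [not_forall, not_le, Fintype.card_fin] at h2
    set B := count fun b : Fin n => ∃ i, α < ((block i).toFinset ∩ fiber h b).card
    have h3 : n ≤ 8 * B := by omega
    refine le_trans ?_ h1
    have h4 : 16 * (c * s * (α * n)) ≤ 8 * (t * B) := by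
      calc 16 * (c * s * (α * n)) ≤ s * (c * s * (α * n)) := by gcongr
        _ = t * n := by simp only [t]; ring
        _ ≤ t * (8 * B) := by gcongr
        _ = _ := by ring
    have h5 : c * cost (A k') (repeatBlocks t L) ≤ c * s * (α * n) := by
      rw [mul_assoc]
      exact Nat.mul_le_mul_left c (hcost.trans (Nat.mul_le_mul_left s hk'k))
    omega
  have : Nonempty (Fin n) := ⟨⟨0, hn⟩⟩
  have hN : (0 : ℝ) < Fintype.card (U → Fin n) := by exact_mod_cast Fintype.card_pos
  have htotal := count_add_count_not fun h : U → Fin n => 7 * n < 8 * count fun b =>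
    ∀ i, ((block i).toFinset ∩ fiber h b).card ≤ α
  have hsub : (count fun h : U → Fin n => ¬ 7 * n < 8 * count fun b =>
      ∀ i, ((block i).toFinset ∩ fiber h b).card ≤ α) ≤
      (Finset.univ.filter fun h : U → Fin n =>
        c * cost (A k') (repeatBlocks t L) + c * s * (α * n) ≤
          localCost A α h (repeatBlocks t L)).card := by
    rw [count_eq_card_filter]
    exact Finset.card_le_card (Finset.monotone_filter_right _ fun h _ hh => hgood h hh)
  rw [le_div_iff₀ hN]
  have htotal' := congrArg (Nat.cast (R := ℝ)) htotal
  push_cast at htotal'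
  have hsub' := Nat.cast_le (α := ℝ) |>.2 hsub
  linarith

end SetAssoc
end

section
/- Let k, α be positive integers with α dividing k, and let δ be a real with 0 < δ < 1 such that (1−δ)·k is a natural number, k/α ≥ 2, and 2δ/(1−δ) ≤ k/α − 2. Let s := 16·exp(8·δ²·α/(1−δ)). Suppose (1−δ)·k balls are thrown independently and uniformly at random into k/α bins. Then with probability at least 1 − exp(−k/(2·α·s)), the number of bins whose load is strictly greater than α is strictly greater than 2k/(α·s). -/
open scoped Classical

theorem sum_mul_mul_card_pow_le {B : Type*} [Fintype B] (a : B) : ∀ (m : ℕ)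
    (φ ψ : (Fin m → B) → ℝ),
    (∀ g i c, φ (Function.update g i a) ≤ φ (Function.update g i c)) →
    (∀ g i c c', c ≠ a → c' ≠ a → φ (Function.update g i c) = φ (Function.update g i c')) →
    (∀ g i c, ψ (Function.update g i c) ≤ ψ (Function.update g i a)) →
    (∑ g, φ g * ψ g) * (Fintype.card B : ℝ) ^ m ≤ (∑ g, φ g) * ∑ g, ψ g := by
  intro m
  induction m with
  | zero => intro φ ψ _ _ _; simp
  | succ m ih =>
    intro φ ψ h1 h2 h3
    have key : ∀ F : (Fin (m + 1) → B) → ℝ, ∑ g, F g = ∑ x, ∑ g, F (Fin.cons x g) := by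
      intro F
      rw [← (Fin.consEquiv (fun _ => B)).sum_comp, Fintype.sum_prod_type]
      rfl
    have upd0 : ∀ (x c : B) (g : Fin m → B),
        Function.update (Fin.cons x g : Fin (m + 1) → B) 0 c = Fin.cons c g := by
      intro x c g; exact Fin.update_cons_zero (α := fun _ => B) x g c
    rw [key, key φ, key ψ]
    have hstep : ∀ x, (∑ g, φ (Fin.cons x g) * ψ (Fin.cons x g)) * (Fintype.card B : ℝ) ^ m ≤
        (∑ g, φ (Fin.cons x g)) * ∑ g, ψ (Fin.cons x g) := by
      intro x
      apply ih (fun g => φ (Fin.cons x g)) (fun g => ψ (Fin.cons x g))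
      · intro g i c; simpa only [Fin.cons_update] using h1 (Fin.cons x g) i.succ c
      · intro g i c c'; simpa only [Fin.cons_update] using h2 (Fin.cons x g) i.succ c c'
      · intro g i c; simpa only [Fin.cons_update] using h3 (Fin.cons x g) i.succ c
    have hanti : Antivary (fun x => ∑ g, φ (Fin.cons x g)) (fun x => ∑ g, ψ (Fin.cons x g)) := by
      intro x y hxy
      by_cases hy : y = a
      · subst hy
        refine Finset.sum_le_sum fun g _ => ?_
        simpa only [upd0] using h1 (Fin.cons x g) 0 x
      · have hx : x ≠ a := by
          rintro rfl
          refine absurd hxy (not_lt.mpr (Finset.sum_le_sum fun g _ => ?_))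
          simpa only [upd0] using h3 (Fin.cons x g) 0 y
        refine (Finset.sum_congr rfl fun g _ => ?_).le
        simpa only [upd0] using h2 (Fin.cons x g) 0 y x hy hx
    have hcheb := hanti.card_mul_sum_le_sum_mul_sum
    calc (∑ x, ∑ g, φ (Fin.cons x g) * ψ (Fin.cons x g)) * (Fintype.card B : ℝ) ^ (m + 1)
        = Fintype.card B *
          ∑ x, (∑ g, φ (Fin.cons x g) * ψ (Fin.cons x g)) * (Fintype.card B : ℝ) ^ m := by
          rw [← Finset.sum_mul]; ring
      _ ≤ Fintype.card B * ∑ x, (∑ g, φ (Fin.cons x g)) * ∑ g, ψ (Fin.cons x g) := by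
          exact mul_le_mul_of_nonneg_left (Finset.sum_le_sum fun x _ => hstep x) (Nat.cast_nonneg _)
      _ ≤ _ := hcheb

/-- The load of bin `b` under the allocation `g`. -/
noncomputable def load {m : ℕ} {B : Type*} (g : Fin m → B) (b : B) : ℕ :=
  (Finset.univ.filter fun i => g i = b).card

theorem load_update {m : ℕ} {B : Type*} (g : Fin m → B) (i : Fin m) (c b : B) :
    load (Function.update g i c) b =
      ((Finset.univ.erase i).filter fun j => g j = b).card + if c = b then 1 else 0 := by
  have h : (Finset.univ : Finset (Fin m)) = insert i (Finset.univ.erase i) := by simp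
  have h2 : ((Finset.univ.erase i).filter fun j => Function.update g i c j = b) =
      (Finset.univ.erase i).filter fun j => g j = b := by
    apply Finset.filter_congr
    intro j hj
    rw [Function.update_of_ne (Finset.ne_of_mem_erase hj)]
  unfold load
  rw [h, Finset.filter_insert, Finset.erase_insert (by simp), h2]
  split_ifs with h3 h4 h4
  · rw [Finset.card_insert_of_notMem (by simp)]
  · simp at h3; contradiction
  · simp at h3; contradiction
  · rfl

theorem sum_prod_load_le {m : ℕ} {B : Type*} [Fintype B] [Nonempty B] (f : ℕ → ℝ)
    (hf : Antitone f) (h0 : ∀ j, 0 ≤ f j) (S : Finset B) :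
    ∑ g : Fin m → B, ∏ b ∈ S, f (load g b) ≤
      (Fintype.card B : ℝ) ^ m *
        ∏ b ∈ S, (∑ g : Fin m → B, f (load g b)) / (Fintype.card B : ℝ) ^ m := by
  have hN : (0 : ℝ) < (Fintype.card B : ℝ) ^ m := by
    have : 0 < Fintype.card B := Fintype.card_pos
    positivity
  induction S using Finset.induction_on with
  | empty => simp
  | insert a S ha ih =>
    simp only [Finset.prod_insert ha]
    have h := sum_mul_mul_card_pow_le a m (fun g => f (load g a))
      (fun g => ∏ b ∈ S, f (load g b)) ?_ ?_ ?_
    · rw [← le_div_iff₀ hN] at h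
      refine h.trans ?_
      rw [div_le_iff₀ hN]
      have hA : 0 ≤ ∑ g : Fin m → B, f (load g a) := Finset.sum_nonneg fun _ _ => h0 _
      calc _ ≤ (∑ g : Fin m → B, f (load g a)) * _ := mul_le_mul_of_nonneg_left ih hA
        _ = _ := by field_simp
    · intro g i c
      apply hf
      simp only [load_update]
      split_ifs <;> simp_all
    · intro g i c c' hc hc'
      simp [load_update, hc, hc']
    · intro g i c
      refine Finset.prod_le_prod (fun _ _ => h0 _) fun b hb => hf ?_
      have : a ≠ b := by rintro rfl; exact ha hb
      simp [load_update, this]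

theorem sum_load {m : ℕ} {B : Type*} [Fintype B] [Nonempty B] (f : ℕ → ℝ) (b : B) :
    ∑ g : Fin m → B, f (load g b) = (Fintype.card B : ℝ) ^ m *
      ∑ j ∈ Finset.range (m + 1),
        f j * (bernsteinPolynomial ℝ m j).eval (1 / (Fintype.card B : ℝ)) := by
  have hpos : 0 < Fintype.card B := Fintype.card_pos
  have hN : (0 : ℝ) < (Fintype.card B : ℝ) := by exact_mod_cast hpos
  have hfib : ∀ S : Finset (Fin m),
      ((Finset.univ.filter fun g : Fin m → B => (Finset.univ.filter fun i => g i = b) = S).card : ℝ)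
        = ((Fintype.card B : ℝ) - 1) ^ (m - S.card) := by
    intro S
    have : (Finset.univ.filter fun g : Fin m → B =>
        (Finset.univ.filter fun i => g i = b) = S) =
        Fintype.piFinset fun i => if i ∈ S then {b} else Finset.univ.erase b := by
      ext g
      simp only [Finset.mem_filter, Finset.mem_univ, true_and, Fintype.mem_piFinset,
        Finset.ext_iff]
      refine forall_congr' fun i => ?_
      by_cases hi : i ∈ S <;> simp [hi]
    rw [this, Fintype.card_piFinset]
    have h2 : ∀ i, (if i ∈ S then ({b} : Finset B) else Finset.univ.erase b).card =
        if i ∈ S then 1 else Fintype.card B - 1 := by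
      intro i; split_ifs <;> simp
    simp only [h2]
    rw [Finset.prod_ite]
    simp only [Finset.prod_const, one_pow, one_mul]
    rw [Finset.filter_not]
    push_cast [Nat.cast_sub (Nat.succ_le_of_lt hpos)]
    congr 1
    rw [Finset.card_sdiff]
    simp
  calc ∑ g : Fin m → B, f (load g b)
      = ∑ S : Finset (Fin m), ∑ g : Fin m → B with (Finset.univ.filter fun i => g i = b) = S,
          f (load g b) := (Finset.sum_fiberwise _ _ _).symm
    _ = ∑ S ∈ (Finset.univ : Finset (Fin m)).powerset,
          ((Fintype.card B : ℝ) - 1) ^ (m - S.card) * f S.card := by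
        rw [Finset.powerset_univ]
        refine Finset.sum_congr rfl fun S _ => ?_
        rw [← hfib S, ← nsmul_eq_mul, ← Finset.sum_const]
        refine Finset.sum_congr rfl fun g hg => ?_
        rw [← (Finset.mem_filter.mp hg).2]; rfl
    _ = _ := by
        rw [Finset.sum_powerset_apply_card
          (fun j => ((Fintype.card B : ℝ) - 1) ^ (m - j) * f j), Finset.mul_sum]
        simp only [Finset.card_univ, Fintype.card_fin, nsmul_eq_mul]
        refine Finset.sum_congr rfl fun j hj => ?_
        have hj' : j ≤ m := Nat.lt_succ_iff.mp (Finset.mem_range.mp hj)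
        simp only [bernsteinPolynomial, Polynomial.eval_mul, Polynomial.eval_natCast,
          Polynomial.eval_pow, Polynomial.eval_X, Polynomial.eval_sub, Polynomial.eval_one]
        have h3 : (1 : ℝ) - 1 / (Fintype.card B : ℝ) =
          ((Fintype.card B : ℝ) - 1) / Fintype.card B := by field_simp
        rw [h3, div_pow, div_pow]
        have h4 : (Fintype.card B : ℝ) ^ m =
          (Fintype.card B : ℝ) ^ j * (Fintype.card B : ℝ) ^ (m - j) := by
            rw [← pow_add]; congr 1; omega
        rw [h4]
        field_simp
        simp

/-- The cumulative distribution function of the binomial law with `m` trials: the probability of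
at most `c` successes, as a polynomial in the success probability. -/
noncomputable def binomialCDF (m c : ℕ) : Polynomial ℝ :=
  ∑ j ∈ Finset.range (c + 1), bernsteinPolynomial ℝ m j

theorem bernsteinPolynomial_succ_succ (m j : ℕ) :
    bernsteinPolynomial ℝ (m + 1) (j + 1) =
      (1 - Polynomial.X) * bernsteinPolynomial ℝ m (j + 1) +
        Polynomial.X * bernsteinPolynomial ℝ m j := by
  simp only [bernsteinPolynomial, Nat.choose_succ_succ, Nat.cast_add, Nat.add_sub_add_right]
  rcases lt_or_ge j m with h | h
  · obtain ⟨d, rfl⟩ := Nat.exists_eq_add_of_lt h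
    have h1 : j + d + 1 - j = d + 1 := by omega
    have h2 : j + d + 1 - (j + 1) = d := by omega
    rw [h1, h2]; ring
  · rw [Nat.choose_eq_zero_of_lt (by omega : m < j + 1)]
    simp; ring

theorem bernsteinPolynomial_succ_zero (m : ℕ) :
    bernsteinPolynomial ℝ (m + 1) 0 = (1 - Polynomial.X) * bernsteinPolynomial ℝ m 0 := by
  simp [bernsteinPolynomial, pow_succ]; ring

theorem binomialCDF_succ_right (m c : ℕ) :
    binomialCDF m (c + 1) = binomialCDF m c + bernsteinPolynomial ℝ m (c + 1) :=
  Finset.sum_range_succ _ _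

theorem binomialCDF_succ_succ (m c : ℕ) :
    binomialCDF (m + 1) (c + 1) =
      (1 - Polynomial.X) * binomialCDF m (c + 1) + Polynomial.X * binomialCDF m c := by
  induction c with
  | zero =>
    simp only [binomialCDF, Finset.sum_range_succ, Finset.sum_range_zero, zero_add,
      bernsteinPolynomial_succ_zero, bernsteinPolynomial_succ_succ m 0]
    ring
  | succ c ih =>
    rw [binomialCDF_succ_right (m + 1), ih, bernsteinPolynomial_succ_succ,
      binomialCDF_succ_right m (c + 1), binomialCDF_succ_right m c]
    ring

theorem derivative_binomialCDF (m c : ℕ) :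
    Polynomial.derivative (binomialCDF m c) = -m * bernsteinPolynomial ℝ (m - 1) c := by
  induction c with
  | zero => simp [binomialCDF, bernsteinPolynomial.derivative_zero]
  | succ c ih =>
    rw [binomialCDF_succ_right, Polynomial.derivative_add, ih, bernsteinPolynomial.derivative_succ]
    ring

theorem eval_bernsteinPolynomial_succ_le {M c : ℕ} {q : ℝ} (h0 : 0 ≤ q) (h1 : q ≤ 1)
    (h : (M + 1) * q ≤ c + 1) :
    (bernsteinPolynomial ℝ M (c + 1)).eval q ≤ (bernsteinPolynomial ℝ M c).eval q := by
  simp only [bernsteinPolynomial, Polynomial.eval_mul, Polynomial.eval_natCast,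
    Polynomial.eval_pow, Polynomial.eval_X, Polynomial.eval_sub, Polynomial.eval_one]
  have h1' : 0 ≤ 1 - q := by linarith
  rcases lt_or_ge c M with hc | hc
  · obtain ⟨d, rfl⟩ := Nat.exists_eq_add_of_lt hc
    have e1 : c + d + 1 - c = d + 1 := by omega
    have e2 : c + d + 1 - (c + 1) = d := by omega
    have hch := Nat.choose_succ_right_eq (c + d + 1) c
    rw [e1] at hch
    have hch' : ((c + d + 1).choose (c + 1) : ℝ) * (c + 1) = (c + d + 1).choose c * (d + 1) := by
      exact_mod_cast hch
    rw [e1, e2]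
    push_cast at h
    have hq : (d + 1) * q ≤ (c + 1) * (1 - q) := by nlinarith
    have hc0 : (0 : ℝ) < c + 1 := by positivity
    refine le_of_mul_le_mul_left ?_ hc0
    have := mul_le_mul_of_nonneg_left hq
      (by positivity : 0 ≤ ((c + d + 1).choose c : ℝ) * (q ^ c * (1 - q) ^ d))
    calc (c + 1 : ℝ) * ((c + d + 1).choose (c + 1) * q ^ (c + 1) * (1 - q) ^ d)
        = ((c + d + 1).choose (c + 1) * (c + 1)) * q ^ (c + 1) * (1 - q) ^ d := by ring
      _ ≤ _ := by rw [hch', pow_succ q, pow_succ (1 - q)]; linarith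
  · rw [Nat.choose_eq_zero_of_lt (by omega : M < c + 1)]
    simp; positivity

theorem eval_binomialCDF_succ_le {m c : ℕ} {μ : ℝ} (hm : 0 < m) (hc : c + 1 ≤ m) (h0 : 0 ≤ μ)
    (hμ : μ ≤ c + 1) :
    (binomialCDF (m + 1) (c + 1)).eval (μ / (m + 1 : ℕ)) ≤
      (binomialCDF m (c + 1)).eval (μ / m) := by
  obtain ⟨M, rfl⟩ := Nat.exists_eq_add_of_lt hm
  rw [zero_add] at *
  set n : ℝ := ((M + 1 : ℕ) : ℝ) with hn
  have hn' : n = M + 1 := by rw [hn]; push_cast; ring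
  have hn0 : 0 < n := by rw [hn']; positivity
  have hcn : (c : ℝ) + 1 ≤ n := by rw [hn]; exact_mod_cast hc
  set G : ℝ → ℝ := fun r => (1 - r) * (binomialCDF (M + 1) (c + 1)).eval ((μ - r) / n) +
    r * (binomialCDF (M + 1) c).eval ((μ - r) / n) with hG
  have hder : ∀ r, HasDerivAt G ((((μ - r) / n) - r) *
      ((bernsteinPolynomial ℝ M (c + 1)).eval ((μ - r) / n) -
        (bernsteinPolynomial ℝ M c).eval ((μ - r) / n))) r := by
    intro r
    have hq : HasDerivAt (fun r : ℝ => (μ - r) / n) (-1 / n) r := by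
      simpa using ((hasDerivAt_id r).const_sub μ).div_const n
    have hA := ((binomialCDF (M + 1) (c + 1)).hasDerivAt ((μ - r) / n)).comp r hq
    have hB := ((binomialCDF (M + 1) c).hasDerivAt ((μ - r) / n)).comp r hq
    have hC := (((hasDerivAt_id r).const_sub 1).mul hA).add ((hasDerivAt_id r).mul hB)
    refine HasDerivAt.congr_deriv (f := G) hC ?_
    have hb := congrArg (Polynomial.eval ((μ - r) / n)) (bernsteinPolynomial_succ_succ M c)
    have hd := congrArg (Polynomial.eval ((μ - r) / n)) (binomialCDF_succ_right (M + 1) c)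
    rw [Polynomial.eval_add] at hb hd
    simp only [Polynomial.eval_mul, Polynomial.eval_sub, Polynomial.eval_one,
      Polynomial.eval_X] at hb
    simp only [derivative_binomialCDF, Nat.add_sub_cancel, Polynomial.eval_mul,
      Polynomial.eval_neg, Polynomial.eval_natCast, Function.comp, id]
    rw [← hn, hd, hb]
    field_simp
    ring
  have hstar : μ / (n + 1) ≤ μ := div_le_self h0 (by linarith)
  have hstar0 : 0 ≤ μ / (n + 1) := by positivity
  have hanti : AntitoneOn G (Set.Icc 0 (μ / (n + 1))) := by
    apply antitoneOn_of_deriv_nonpos (convex_Icc _ _)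
    · exact fun r _ => (hder r).continuousAt.continuousWithinAt
    · exact fun r _ => (hder r).differentiableAt.differentiableWithinAt
    · intro r hr
      rw [interior_Icc] at hr
      rw [(hder r).deriv]
      have hr1 : r * (n + 1) ≤ μ := by
        have := (lt_div_iff₀ (by positivity)).mp hr.2
        linarith
      apply mul_nonpos_of_nonneg_of_nonpos
      · rw [sub_nonneg, le_div_iff₀ hn0]; linarith
      · rw [sub_nonpos]
        apply eval_bernsteinPolynomial_succ_le
        · apply div_nonneg _ hn0.le; linarith [hr.2]
        · rw [div_le_one hn0]; linarith [hr.1]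
        · rw [← hn', mul_div_cancel₀ _ hn0.ne']; linarith [hr.1]
  have h := hanti (Set.left_mem_Icc.mpr hstar0) (Set.right_mem_Icc.mpr hstar0) hstar0
  have hqq : (μ - μ / (n + 1)) / n = μ / (n + 1) := by field_simp; ring
  simp only [hG, hqq, sub_zero, zero_mul, add_zero, one_mul] at h
  rw [binomialCDF_succ_succ, show ((M + 1 + 1 : ℕ) : ℝ) = n + 1 by rw [hn]; push_cast; ring]
  simpa using h

theorem eval_binomialCDF_le_of_le {M m c : ℕ} {μ : ℝ} (hc : c + 1 ≤ M) (h0 : 0 ≤ μ)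
    (hμ : μ ≤ c + 1) (hMm : M ≤ m) :
    (binomialCDF m (c + 1)).eval (μ / m) ≤ (binomialCDF M (c + 1)).eval (μ / M) := by
  induction m, hMm using Nat.le_induction with
  | base => exact le_rfl
  | succ m hm ih => exact (eval_binomialCDF_succ_le (by omega) (by omega) h0 hμ).trans ih

theorem centralBinom_sq_mul_le (n : ℕ) : n.centralBinom ^ 2 * (3 * n + 1) ≤ 16 ^ n := by
  induction n with
  | zero => simp
  | succ n ih =>
    have h := Nat.succ_mul_centralBinom_succ n
    refine le_of_mul_le_mul_left ?_ (by positivity : 0 < (n + 1) ^ 2 * (3 * n + 1))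
    calc (n + 1) ^ 2 * (3 * n + 1) * ((n + 1).centralBinom ^ 2 * (3 * (n + 1) + 1))
        = ((n + 1) * (n + 1).centralBinom) ^ 2 * ((3 * n + 1) * (3 * n + 4)) := by ring
      _ = n.centralBinom ^ 2 * (3 * n + 1) * (4 * (2 * n + 1) ^ 2 * (3 * n + 4)) := by
        rw [h]; ring
      _ ≤ 16 ^ n * (4 * (4 * (n + 1) ^ 2 * (3 * n + 1))) := by
        gcongr ?_ * ?_
        nlinarith
      _ = _ := by ring

theorem two_mul_sum_choose_add_centralBinom (n : ℕ) :
    2 * ∑ i ∈ Finset.range n, (2 * n).choose (n + 1 + i) + n.centralBinom = 4 ^ n := by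
  have h := Nat.sum_range_choose (2 * n)
  rw [show 2 * n + 1 = n + 1 + n by ring, Finset.sum_range_add, Finset.sum_range_succ,
    pow_mul] at h
  have h2 : ∑ i ∈ Finset.range n, (2 * n).choose i =
      ∑ i ∈ Finset.range n, (2 * n).choose (n + 1 + i) := by
    rw [← Finset.sum_range_reflect]
    refine Finset.sum_congr rfl fun i hi => ?_
    have hi' := Finset.mem_range.mp hi
    rw [← Nat.choose_symm (by omega)]
    congr 1; omega
  rw [h2] at h
  have h3 : (2 * n).choose n = n.centralBinom := rfl
  rw [h3] at h
  norm_num at h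
  omega

theorem two_mul_sum_mul_choose (n : ℕ) :
    2 * ∑ i ∈ Finset.range n, (i + 1) * (2 * n).choose (n + 1 + i) = n * n.centralBinom := by
  have key : ∀ N ≤ n, 2 * ∑ i ∈ Finset.range N, (i + 1) * (2 * n).choose (n + 1 + i) +
      (n - N) * (2 * n).choose (n + N) = n * n.centralBinom := by
    intro N hN
    induction N with
    | zero => simp [Nat.centralBinom]
    | succ N ih =>
      rw [← ih (by omega), Finset.sum_range_succ]
      have h := Nat.choose_succ_right_eq (2 * n) (n + N)
      rw [show 2 * n - (n + N) = n - N by omega] at h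
      rw [mul_comm (n - N), ← h, show n + 1 + N = n + N + 1 by ring,
        show n + (N + 1) = n + N + 1 by ring]
      obtain ⟨d, rfl⟩ := Nat.exists_eq_add_of_le hN
      rw [Nat.add_sub_cancel_left]
      ring
  simpa using key n le_rfl

theorem one_sub_eval_binomialCDF_two_mul (n : ℕ) {δ : ℝ} (hδ : 1 + δ ≠ 0) :
    1 - (binomialCDF (2 * n) n).eval ((1 - δ) / 2) =
      (1 - δ ^ 2) ^ n / 4 ^ n * ∑ i ∈ Finset.range n,
        ((2 * n).choose (n + 1 + i) : ℝ) * ((1 - δ) / (1 + δ)) ^ (i + 1) := by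
  have h := congrArg (Polynomial.eval ((1 - δ) / 2)) (bernsteinPolynomial.sum ℝ (2 * n))
  rw [show 2 * n + 1 = n + 1 + n by ring, Finset.sum_range_add, Polynomial.eval_add,
    Polynomial.eval_one] at h
  rw [binomialCDF, sub_eq_of_eq_add' h.symm, Polynomial.eval_finsetSum, Finset.mul_sum]
  refine Finset.sum_congr rfl fun i hi => ?_
  obtain ⟨d, rfl⟩ := Nat.exists_eq_add_of_lt (Finset.mem_range.mp hi)
  simp only [bernsteinPolynomial, Polynomial.eval_mul, Polynomial.eval_natCast,
    Polynomial.eval_pow, Polynomial.eval_X, Polynomial.eval_sub, Polynomial.eval_one]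
  rw [show 2 * (i + d + 1) - (i + d + 1 + 1 + i) = d by omega,
    show (1 : ℝ) - (1 - δ) / 2 = (1 + δ) / 2 by ring,
    show (1 : ℝ) - δ ^ 2 = (1 - δ) * (1 + δ) by ring, show (4 : ℝ) = 2 * 2 by norm_num]
  simp only [div_pow, mul_pow]
  field_simp
  ring

theorem centralBinom_div_sq_mul_le (n : ℕ) :
    ((n.centralBinom : ℝ) / 4 ^ n) ^ 2 * (3 * n + 1) ≤ 1 := by
  have h : ((n.centralBinom : ℝ)) ^ 2 * (3 * n + 1) ≤ 16 ^ n := by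
    exact_mod_cast centralBinom_sq_mul_le n
  rw [div_pow, ← pow_mul, mul_comm n 2, pow_mul, div_mul_eq_mul_div, div_le_one (by positivity)]
  norm_num
  exact h

theorem exp_mul_sum_le_sum_mul_pow {ι : Type*} (s : Finset ι) (c : ι → ℝ) (a : ι → ℕ)
    (hc : ∀ i ∈ s, 0 ≤ c i) {ρ e : ℝ} (hρ0 : 0 < ρ) (hρ1 : ρ ≤ 1)
    (he : ∑ i ∈ s, c i * a i ≤ e * ∑ i ∈ s, c i) :
    Real.exp (e * Real.log ρ) * ∑ i ∈ s, c i ≤ ∑ i ∈ s, c i * ρ ^ a i := by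
  set l : ℝ := Real.log ρ with hl
  have hl0 : l ≤ 0 := Real.log_nonpos hρ0.le hρ1
  have hterm : ∀ n : ℕ, Real.exp (e * l) * (1 + ((n : ℝ) - e) * l) ≤ ρ ^ n := by
    intro n
    have h2 : ρ ^ n = Real.exp (e * l) * Real.exp (((n : ℝ) - e) * l) := by
      rw [← Real.exp_add, ← Real.exp_log (pow_pos hρ0 n), Real.log_pow, hl]
      congr 1; ring
    rw [h2]
    refine mul_le_mul_of_nonneg_left ?_ (Real.exp_pos _).le
    linarith [Real.add_one_le_exp (((n : ℝ) - e) * l)]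
  calc Real.exp (e * l) * ∑ i ∈ s, c i
      ≤ Real.exp (e * l) *
          (∑ i ∈ s, c i + l * (∑ i ∈ s, c i * a i - e * ∑ i ∈ s, c i)) := by
        refine mul_le_mul_of_nonneg_left ?_ (Real.exp_pos _).le
        linarith [mul_nonneg_of_nonpos_of_nonpos hl0 (sub_nonpos.mpr he)]
    _ = ∑ i ∈ s, c i * (Real.exp (e * l) * (1 + ((a i : ℝ) - e) * l)) := by
        rw [Finset.mul_sum _ _ e, ← Finset.sum_sub_distrib, Finset.mul_sum _ _ l,
          ← Finset.sum_add_distrib, Finset.mul_sum]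
        exact Finset.sum_congr rfl fun i _ => by ring
    _ ≤ _ := Finset.sum_le_sum fun i hi => mul_le_mul_of_nonneg_left (hterm _) (hc i hi)

theorem exp_neg_le_one_sub_sq_pow (n : ℕ) {δ : ℝ} (h0 : 0 ≤ δ) (h1 : δ < 1) :
    Real.exp (-(n * (δ ^ 2 / (1 - δ)))) ≤ (1 - δ ^ 2) ^ n := by
  have hd1 : 0 < 1 - δ := by linarith
  have hpos : 0 < 1 - δ ^ 2 := by nlinarith
  have h2 : -(δ ^ 2 / (1 - δ)) ≤ Real.log (1 - δ ^ 2) := by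
    refine le_trans ?_ (Real.one_sub_inv_le_log_of_pos hpos)
    have : 1 - (1 - δ ^ 2)⁻¹ = -(δ ^ 2 / (1 - δ ^ 2)) := by field_simp; ring
    rw [this]
    apply neg_le_neg
    apply div_le_div_of_nonneg_left (by positivity) hd1
    nlinarith
  calc Real.exp (-(n * (δ ^ 2 / (1 - δ)))) = Real.exp (-(δ ^ 2 / (1 - δ))) ^ n := by
        rw [← Real.exp_nat_mul]; congr 1; ring
    _ ≤ (1 - δ ^ 2) ^ n := by
        refine pow_le_pow_left₀ (Real.exp_pos _).le ?_ n
        rw [← Real.exp_log hpos]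
        exact Real.exp_le_exp.mpr h2

theorem exp_one_quarter_le : Real.exp (1 / 4) ≤ 13 / 10 := by
  have h : Real.exp (1 / 4) ^ 4 ≤ (13 / 10) ^ 4 := by
    rw [← Real.exp_nat_mul]
    norm_num
    linarith [Real.exp_one_lt_d9]
  exact le_of_pow_le_pow_left₀ (by norm_num) (by norm_num) h

theorem neg_le_quarter_sub {n e δ l : ℝ} (hn : 2 ≤ n) (h0 : 0 < δ) (h1 : δ < 1) (he0 : 0 ≤ e)
    (he : e ^ 2 ≤ 87 / 100 * n) (hl : -(2 * δ / (1 - δ)) ≤ l) :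
    -(8 * δ ^ 2 * n / (1 - δ)) ≤ 1 / 4 + (-(n * (δ ^ 2 / (1 - δ))) + e * l) := by
  have hd1 : 0 < 1 - δ := by linarith
  have hb : (2 * e + 1 / 4) ^ 2 ≤ 7 * n := by nlinarith [sq_nonneg (e - 1 / 2)]
  have hquad : 0 ≤ 7 * n * δ ^ 2 - 2 * e * δ + (1 - δ) / 4 := by
    refine nonneg_of_mul_nonneg_right (a := 28 * n) ?_ (by positivity)
    calc 0 ≤ (14 * n * δ - (2 * e + 1 / 4)) ^ 2 + (7 * n - (2 * e + 1 / 4) ^ 2) := by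
          linarith [sq_nonneg (14 * n * δ - (2 * e + 1 / 4))]
      _ = _ := by ring
  have h2 : -(e * (2 * δ / (1 - δ))) ≤ e * l := by
    rw [← mul_neg]; exact mul_le_mul_of_nonneg_left hl he0
  have h3 : 0 ≤ (7 * n * δ ^ 2 - 2 * e * δ + (1 - δ) / 4) / (1 - δ) := div_nonneg hquad hd1.le
  have h4 : (7 * n * δ ^ 2 - 2 * e * δ + (1 - δ) / 4) / (1 - δ) =
      8 * δ ^ 2 * n / (1 - δ) - n * (δ ^ 2 / (1 - δ)) - e * (2 * δ / (1 - δ)) + 1 / 4 := by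
    field_simp; ring
  linarith

theorem eval_binomialCDF_two_mul_le {n : ℕ} (hn : 2 ≤ n) {δ : ℝ} (h0 : 0 < δ) (h1 : δ < 1) :
    59 / 250 * Real.exp (-(8 * δ ^ 2 * n / (1 - δ))) ≤
      1 - (binomialCDF (2 * n) n).eval ((1 - δ) / 2) := by
  have hd1 : 0 < 1 - δ := by linarith
  have hd2 : 0 < 1 + δ := by linarith
  have hn2 : (2 : ℝ) ≤ n := by exact_mod_cast hn
  have hpos : 0 < 1 - δ ^ 2 := by nlinarith
  rw [one_sub_eval_binomialCDF_two_mul n hd2.ne']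
  have hwn := centralBinom_div_sq_mul_le n
  set w : ℝ := n.centralBinom / 4 ^ n with hw
  have hw0 : 0 ≤ w := by positivity
  have hw1 : w ≤ 38 / 100 := by nlinarith
  have hw' : 4 ^ n * w = n.centralBinom := by rw [hw]; field_simp
  clear_value w
  have hS : (∑ i ∈ Finset.range n, ((2 * n).choose (n + 1 + i) : ℝ)) = 4 ^ n * ((1 - w) / 2) := by
    have h : 2 * (∑ i ∈ Finset.range n, ((2 * n).choose (n + 1 + i) : ℝ)) + n.centralBinom =
        4 ^ n := by exact_mod_cast two_mul_sum_choose_add_centralBinom n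
    linarith
  have hM : (∑ i ∈ Finset.range n, ((2 * n).choose (n + 1 + i) : ℝ) * ((i + 1 : ℕ) : ℝ)) =
      4 ^ n * (n * w / 2) := by
    have h : 2 * (∑ i ∈ Finset.range n, ((2 * n).choose (n + 1 + i) : ℝ) * ((i + 1 : ℕ) : ℝ)) =
        n * n.centralBinom := by
      simp only [mul_comm ((2 * n).choose _ : ℝ)]
      exact_mod_cast two_mul_sum_mul_choose n
    rw [← hw'] at h
    linarith
  set e : ℝ := n * w / (62 / 100) with he
  have he0 : 0 ≤ e := by positivity
  have he2 : e ^ 2 ≤ 87 / 100 * n := by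
    rw [he, div_pow, div_le_iff₀ (by norm_num)]
    nlinarith
  have hew : n * w = e * (62 / 100) := by rw [he]; field_simp
  clear_value e
  set ρ : ℝ := (1 - δ) / (1 + δ) with hρ
  have hρ0 : 0 < ρ := by positivity
  have hρ1 : ρ ≤ 1 := by rw [hρ, div_le_one hd2]; linarith
  have hl1 : -(2 * δ / (1 - δ)) ≤ Real.log ρ := by
    refine le_trans (le_of_eq ?_) (Real.one_sub_inv_le_log_of_pos hρ0)
    rw [hρ]; field_simp; ring
  have hsum := exp_mul_sum_le_sum_mul_pow (Finset.range n)
    (fun i => ((2 * n).choose (n + 1 + i) : ℝ)) (fun i => i + 1) (fun _ _ => Nat.cast_nonneg _)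
    (e := e) hρ0 hρ1 (by
      rw [hS, hM, mul_left_comm, hew]
      refine mul_le_mul_of_nonneg_left ?_ (by positivity)
      nlinarith)
  rw [hS] at hsum
  have hpow := exp_neg_le_one_sub_sq_pow n h0.le h1
  have hexp := neg_le_quarter_sub hn2 h0 h1 he0 he2 hl1
  calc 59 / 250 * Real.exp (-(8 * δ ^ 2 * n / (1 - δ)))
      ≤ 59 / 250 * Real.exp (1 / 4 + (-(n * (δ ^ 2 / (1 - δ))) + e * Real.log ρ)) := by gcongr
    _ = 59 / 250 * Real.exp (1 / 4) *
          (Real.exp (-(n * (δ ^ 2 / (1 - δ)))) * Real.exp (e * Real.log ρ)) := by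
        rw [Real.exp_add, Real.exp_add]; ring
    _ ≤ (1 - w) / 2 * ((1 - δ ^ 2) ^ n * Real.exp (e * Real.log ρ)) := by
        have hq : 59 / 250 * Real.exp (1 / 4) ≤ (1 - w) / 2 := by linarith [exp_one_quarter_le]
        exact mul_le_mul hq (by gcongr) (by positivity) (by linarith)
    _ = (1 - δ ^ 2) ^ n / 4 ^ n * (Real.exp (e * Real.log ρ) * (4 ^ n * ((1 - w) / 2))) := by
        field_simp
    _ ≤ _ := mul_le_mul_of_nonneg_left hsum (by positivity)

theorem exp_neg_mul_le_of_le {x a b : ℝ} (hb : 0 ≤ b) (hx : 0 ≤ x)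
    (h : a ≤ b * (1 + x + x ^ 2 / 2)) : a * Real.exp (-x) ≤ b := by
  rw [Real.exp_neg, ← div_eq_mul_inv, div_le_iff₀ (Real.exp_pos _)]
  exact h.trans (mul_le_mul_of_nonneg_left (Real.quadratic_le_exp_of_nonneg hx) hb)

theorem eval_binomialCDF_two_one_le {δ : ℝ} (h0 : 1 / 4 ≤ δ) (h1 : δ < 1) :
    59 / 250 * Real.exp (-(8 * δ ^ 2 / (1 - δ))) ≤
      1 - (binomialCDF 2 1).eval ((1 - δ) / 2) := by
  have hd1 : 0 < 1 - δ := by linarith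
  have hT : 1 - (binomialCDF 2 1).eval ((1 - δ) / 2) = (1 - δ) ^ 2 / 4 := by
    simp [binomialCDF, Finset.sum_range_succ, bernsteinPolynomial]
    ring
  rw [hT]
  apply exp_neg_mul_le_of_le (by positivity) (by positivity)
  have : (1 - δ) ^ 2 / 4 * (1 + 8 * δ ^ 2 / (1 - δ) + (8 * δ ^ 2 / (1 - δ)) ^ 2 / 2) =
      ((1 - δ) ^ 2 + 8 * δ ^ 2 * (1 - δ) + 32 * δ ^ 4) / 4 := by
    field_simp
    ring
  rw [this]
  nlinarith [sq_nonneg (δ ^ 2 - 1 / 16), sq_nonneg (δ - 1 / 4), mul_nonneg (sub_nonneg.2 h0) hd1.le]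

theorem eval_binomialCDF_four_one_le {δ : ℝ} (h0 : 0 < δ) (h1 : δ < 1 / 4) :
    59 / 250 * Real.exp (-(8 * δ ^ 2 / (1 - δ))) ≤
      1 - (binomialCDF 4 1).eval ((1 - δ) / 4) := by
  have hd1 : 0 < 1 - δ := by linarith
  set p := (1 - δ) / 4 with hp
  have hT : 1 - (binomialCDF 4 1).eval p = p ^ 2 * (6 - 8 * p + 3 * p ^ 2) := by
    simp [binomialCDF, Finset.sum_range_succ, bernsteinPolynomial]
    ring
  have hb : 0 ≤ 6 - 8 * p + 3 * p ^ 2 := by nlinarith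
  rw [hT]
  apply exp_neg_mul_le_of_le (by positivity) (by positivity)
  refine le_trans (b := p ^ 2 * (6 - 8 * p + 3 * p ^ 2) * (1 + 8 * δ ^ 2 / (1 - δ))) ?_ ?_
  · have : p ^ 2 * (6 - 8 * p + 3 * p ^ 2) * (1 + 8 * δ ^ 2 / (1 - δ)) =
        (1 - δ) * (6 - 8 * p + 3 * p ^ 2) * (1 - δ + 8 * δ ^ 2) / 16 := by
      rw [hp]; field_simp; ring
    rw [this, hp]
    have h3 : δ ^ 3 ≤ δ ^ 2 / 4 := by nlinarith [sq_nonneg δ]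
    have h4 : δ ^ 4 ≤ δ ^ 2 / 16 := by nlinarith [sq_nonneg δ]
    have h5 : δ ^ 5 ≤ δ ^ 2 / 64 := by nlinarith [sq_nonneg δ]
    nlinarith [sq_nonneg (δ - 29 / 250)]
  · have : 0 ≤ (8 * δ ^ 2 / (1 - δ)) ^ 2 / 2 := by positivity
    refine mul_le_mul_of_nonneg_left (by linarith) (by positivity)

theorem eval_binomialCDF_one_div_le {k α m n : ℕ} (hα : 0 < α) (hk : k = n * α) {δ : ℝ}
    (h0 : 0 < δ) (h1 : δ < 1) (hm : (m : ℝ) = (1 - δ) * k) (hn : 0 < n) (h2 : 2 * α ≤ m) :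
    59 / 250 * Real.exp (-(8 * δ ^ 2 * α / (1 - δ))) ≤
      1 - (binomialCDF m α).eval (1 / (n : ℝ)) := by
  obtain ⟨c, rfl⟩ := Nat.exists_eq_succ_of_ne_zero hα.ne'
  have hn0 : (0 : ℝ) < n := by exact_mod_cast hn
  have hm0 : (0 : ℝ) < m := by exact_mod_cast (by omega : 0 < m)
  have hc0 : (0 : ℝ) < c + 1 := by positivity
  set μ : ℝ := (1 - δ) * (c + 1) with hμ
  have hμ0 : 0 ≤ μ := mul_nonneg (by linarith) hc0.le
  have hμ1 : μ ≤ c + 1 := by nlinarith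
  have hmn : 1 / (n : ℝ) = μ / m := by
    rw [hm, hk, hμ]; push_cast
    have : 1 - δ ≠ 0 := by linarith
    field_simp
  rw [hmn]
  have hmono : ∀ M : ℕ, c + 1 ≤ M → M ≤ m →
      1 - (binomialCDF M (c + 1)).eval (μ / M) ≤ 1 - (binomialCDF m (c + 1)).eval (μ / m) :=
    fun M hM hMm => sub_le_sub_left (eval_binomialCDF_le_of_le hM hμ0 hμ1 hMm) 1
  rcases Nat.eq_zero_or_pos c with rfl | hc
  · have hμ' : μ = 1 - δ := by rw [hμ]; simp
    rw [hμ'] at hmono ⊢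
    simp only [Nat.succ_eq_add_one, zero_add, Nat.cast_one, mul_one] at *
    rcases le_or_gt (1 / 4) δ with hδ | hδ
    · exact (eval_binomialCDF_two_one_le hδ h1).trans (by simpa using hmono 2 (by norm_num) h2)
    · suffices h4 : 4 ≤ m from
        (eval_binomialCDF_four_one_le h0 hδ).trans (by simpa using hmono 4 (by norm_num) h4)
      have hlt : m < k := by
        have hk0 : (0 : ℝ) < k := by rw [hk]; exact hn0
        have : (m : ℝ) < k := by rw [hm]; nlinarith
        exact_mod_cast this
      have hlt' : (m : ℝ) + 1 ≤ k := by exact_mod_cast hlt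
      have : (3 : ℝ) < m := by nlinarith
      exact_mod_cast this
  · refine (eval_binomialCDF_two_mul_le (n := c + 1) (by omega) h0 h1).trans ?_
    refine le_trans (le_of_eq ?_) (hmono (2 * (c + 1)) (by omega) h2)
    congr 2
    rw [hμ]; push_cast; field_simp

theorem card_overflow_le_div_le_exp {m : ℕ} {B : Type*} [Fintype B] [Nonempty B] {c : ℕ}
    (hc : c ≤ m) (T : ℝ) :
    ((Finset.univ.filter fun g : Fin m → B =>
        ((Finset.univ.filter fun b => c < load g b).card : ℝ) ≤ T).card : ℝ) /
        (Fintype.card B : ℝ) ^ m ≤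
      Real.exp (T * Real.log 2 - Fintype.card B *
        (1 - (binomialCDF m c).eval (1 / (Fintype.card B : ℝ))) / 2) := by
  have hpos : 0 < Fintype.card B := Fintype.card_pos
  have hN : (0 : ℝ) < (Fintype.card B : ℝ) ^ m := by positivity
  set Y : (Fin m → B) → ℕ := fun g => (Finset.univ.filter fun b => c < load g b).card with hY
  set q : ℝ := 1 - (binomialCDF m c).eval (1 / (Fintype.card B : ℝ)) with hq
  set f : ℕ → ℝ := fun j => if c < j then 1 / 2 else 1 with hf
  have hf_anti : Antitone f := by
    intro i j hij
    simp only [hf]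
    split_ifs <;> first | omega | norm_num
  have hf_nonneg : ∀ j, 0 ≤ f j := by
    intro j; simp only [hf]; split_ifs <;> norm_num
  have hprod : ∀ g : Fin m → B, ∏ b, f (load g b) = (1 / 2) ^ Y g := by
    intro g
    simp [hf, hY, Finset.prod_ite]
  have hmean : ∀ b : B, (∑ g : Fin m → B, f (load g b)) / (Fintype.card B : ℝ) ^ m = 1 - q / 2 := by
    intro b
    rw [sum_load, mul_div_cancel_left₀ _ hN.ne']
    have hsum := congrArg (Polynomial.eval (1 / (Fintype.card B : ℝ))) (bernsteinPolynomial.sum ℝ m)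
    have hcdf : (binomialCDF m c).eval (1 / (Fintype.card B : ℝ)) =
        ∑ j ∈ Finset.range (m + 1), if c < j then 0 else
          (bernsteinPolynomial ℝ m j).eval (1 / (Fintype.card B : ℝ)) := by
      rw [binomialCDF, Polynomial.eval_finsetSum, Finset.sum_ite, Finset.sum_const_zero, zero_add]
      congr 1
      ext j
      simp only [Finset.mem_range, Finset.mem_filter]
      omega
    rw [Polynomial.eval_finsetSum, Polynomial.eval_one] at hsum
    have hsplit : ∀ j, f j * (bernsteinPolynomial ℝ m j).eval (1 / (Fintype.card B : ℝ)) =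
        1 / 2 * (bernsteinPolynomial ℝ m j).eval (1 / (Fintype.card B : ℝ)) +
        1 / 2 * if c < j then 0 else
          (bernsteinPolynomial ℝ m j).eval (1 / (Fintype.card B : ℝ)) := by
      intro j; simp only [hf]; split_ifs <;> ring
    simp only [hsplit]
    rw [Finset.sum_add_distrib, ← Finset.mul_sum, ← Finset.mul_sum, hsum, ← hcdf, hq]
    ring
  have hle := sum_prod_load_le (m := m) (B := B) f hf_anti hf_nonneg Finset.univ
  simp only [hprod, hmean, Finset.prod_const, Finset.card_univ] at hle
  have hmean0 : 0 ≤ 1 - q / 2 := by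
    rw [← hmean (Classical.arbitrary B)]
    exact div_nonneg (Finset.sum_nonneg fun _ _ => hf_nonneg _) hN.le
  have hpow : (1 - q / 2) ^ Fintype.card B ≤ Real.exp (-(Fintype.card B * q / 2)) := by
    calc (1 - q / 2) ^ Fintype.card B ≤ Real.exp (-(q / 2)) ^ Fintype.card B :=
          pow_le_pow_left₀ hmean0 (Real.one_sub_le_exp_neg _) _
      _ = _ := by rw [← Real.exp_nat_mul]; congr 1; ring
  have hmarkov : ((Finset.univ.filter fun g => (Y g : ℝ) ≤ T).card : ℝ) *
      Real.exp (-(T * Real.log 2)) ≤ ∑ g, (1 / 2 : ℝ) ^ Y g := by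
    rw [← nsmul_eq_mul, ← Finset.sum_const]
    refine le_trans (Finset.sum_le_sum fun g hg => ?_)
      (Finset.sum_le_sum_of_subset_of_nonneg (Finset.filter_subset _ _) fun _ _ _ => by positivity)
    have hg' : (Y g : ℝ) ≤ T := (Finset.mem_filter.mp hg).2
    rw [← Real.exp_log (by positivity : (0 : ℝ) < (1 / 2) ^ Y g), Real.log_pow, one_div,
      Real.log_inv]
    apply Real.exp_le_exp.mpr
    linarith [mul_le_mul_of_nonneg_right hg' (Real.log_nonneg one_le_two)]
  rw [div_le_iff₀ hN, sub_eq_add_neg, Real.exp_add]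
  have h := hmarkov.trans (hle.trans (mul_le_mul_of_nonneg_left hpow hN.le))
  rw [Real.exp_neg, ← div_eq_mul_inv, div_le_iff₀ (Real.exp_pos _)] at h
  linarith

/-- **Overflowing bins (Claim 5.6).** Let `α ∣ k`, `0 < δ < 1` with `m = (1-δ)k ∈ ℕ`,
`k/α ≥ 2` bins and `2δ/(1-δ) ≤ k/α - 2`, and let `s := 16·exp(8δ²α/(1-δ))`. Throw
`m` balls independently and uniformly at random into `k/α` bins. Then with probability
at least `1 - exp(-k/(2αs))`, strictly more than `2k/(αs)` bins receive more than `α`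
balls. -/
theorem overflowing_bins_lower_bound
    (k α m : ℕ) (hk : 0 < k) (hα : 0 < α) (hdvd : α ∣ k)
    (δ : ℝ) (hδ0 : 0 < δ) (hδ1 : δ < 1)
    (hm : (m : ℝ) = (1 - δ) * k)
    (hn2 : 2 ≤ k / α)
    (hε : 2 * δ / (1 - δ) ≤ (k : ℝ) / (α : ℝ) - 2) :
    (1 : ℝ) - Real.exp (-(k : ℝ) /
        (2 * α * (16 * Real.exp (8 * δ ^ 2 * α / (1 - δ))))) ≤
      ((Finset.univ.filter (fun g : Fin m → Fin (k / α) =>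
          2 * (k : ℝ) / ((α : ℝ) * (16 * Real.exp (8 * δ ^ 2 * α / (1 - δ)))) <
            ((Finset.univ.filter (fun b : Fin (k / α) =>
                α < (Finset.univ.filter (fun i : Fin m => g i = b)).card)).card :
              ℝ))).card : ℝ) /
        (Fintype.card (Fin m → Fin (k / α)) : ℝ) := by
  generalize hnk : k / α = n at hn2 ⊢
  obtain rfl : k = α * n := by rw [← hnk, Nat.mul_div_cancel' hdvd]
  have hn : 0 < n := by omega
  have : Nonempty (Fin n) := ⟨⟨0, hn⟩⟩
  have hα0 : (0 : ℝ) < α := by exact_mod_cast hα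
  have hn0 : (0 : ℝ) < n := by exact_mod_cast hn
  have hd1 : 0 < 1 - δ := by linarith
  have hm2 : 2 * α ≤ m := by
    have h : 2 * δ / (1 - δ) ≤ n - 2 := by
      rwa [Nat.cast_mul, mul_div_cancel_left₀ _ hα0.ne'] at hε
    rw [div_le_iff₀ hd1] at h
    have h' : (2 : ℝ) * α ≤ m := by
      rw [hm]; push_cast; nlinarith
    exact_mod_cast h'
  have hq := eval_binomialCDF_one_div_le hα (mul_comm α n) hδ0 hδ1 hm hn hm2
  set x : ℝ := 8 * δ ^ 2 * α / (1 - δ) with hx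
  set E : ℝ := Real.exp (-x) with hE
  have hE0 : 0 < E := Real.exp_pos _
  have hEx : Real.exp x = E⁻¹ := by rw [hE, Real.exp_neg, inv_inv]
  have hT : 2 * ((α * n : ℕ) : ℝ) / ((α : ℝ) * (16 * Real.exp x)) = n * E / 8 := by
    rw [hEx]; push_cast; field_simp; norm_num
  have hR : -((α * n : ℕ) : ℝ) / (2 * α * (16 * Real.exp x)) = -(n * E / 32) := by
    rw [hEx]; push_cast; field_simp; norm_num
  rw [hT, hR]
  have htail := card_overflow_le_div_le_exp (m := m) (B := Fin n) (c := α) (by omega) (n * E / 8)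
  simp only [Fintype.card_fin] at htail
  have hexp : Real.exp (n * E / 8 * Real.log 2 -
      n * (1 - (binomialCDF m α).eval (1 / (n : ℝ))) / 2) ≤ Real.exp (-(n * E / 32)) := by
    apply Real.exp_le_exp.mpr
    have h1 := mul_le_mul_of_nonneg_left hq hn0.le
    have h2 := mul_le_mul_of_nonneg_left Real.log_two_lt_d9.le (mul_pos hn0 hE0).le
    nlinarith [mul_pos hn0 hE0]
  have hcard : (Fintype.card (Fin m → Fin n) : ℝ) = (n : ℝ) ^ m := by simp
  have hN : (0 : ℝ) < (n : ℝ) ^ m := by positivity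
  have hsplit := Finset.card_filter_add_card_filter_not (s := Finset.univ)
    (fun g : Fin m → Fin n =>
      n * E / 8 < ((Finset.univ.filter fun b => α < load g b).card : ℝ))
  simp only [not_lt, Finset.card_univ] at hsplit
  have hsplit' := congrArg (Nat.cast (R := ℝ)) hsplit
  rw [Nat.cast_add, hcard] at hsplit'
  rw [hcard, le_div_iff₀ hN]
  have hbad := (div_le_iff₀ hN).mp (htail.trans hexp)
  have hgood : (1 - Real.exp (-(n * E / 32))) * (n : ℝ) ^ m ≤ ((Finset.univ.filter
      fun g : Fin m → Fin n =>
        n * E / 8 < ((Finset.univ.filter fun b => α < load g b).card : ℝ)).card : ℝ) := by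
    linarith
  have hload : ∀ (g : Fin m → Fin n) b, (Finset.univ.filter fun i => g i = b).card = load g b := by
    intro g b
    unfold load
    congr!
  refine hgood.trans_eq ?_
  simp only [hload]
end
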